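/- Edrei's classification of normalized totally positive sequences (Theorem 9.A): let φ : ℤ → ℝ. The following are equivalent. (1) φ_n ≥ 0 for all n, ∑_{n∈ℤ} φ_n = 1, and φ is totally positive. (2) There exist nonincreasing sequences of nonnegative reals α⁺ = (α⁺_i)_{i≥1}, α⁻, β⁺, β⁻ with ∑_{i≥1}(α⁺_i + β⁺_i) < ∞, ∑_{i≥1}(α⁻_i + β⁻_i) < ∞ and β⁺_1 + β⁻_1 ≤ 1, and real numbers γ⁺ ≥ 0, γ⁻ ≥ 0, such that for every complex number u with |u| = 1 the series ∑_{n∈ℤ} φ_n u^n converges absolutely and equals e^{γ⁺(u−1) + γ⁻(u^{−1}−1)} · ∏_{i=1}^∞ [ (1+β⁺_i(u−1))·(1+β⁻_i(u^{−1}−1)) ] / [ (1−α⁺_i(u−1))·(1−α⁻_i(u^{−1}−1)) ], where the infinite product converges (all denominator factors are nonzero for |u| = 1). -/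

import Mathlib

/-- A two-sided sequence `φ : ℤ → ℝ` is *totally positive* if all minors of the two-sided
infinite Toeplitz matrix `T(i,j) = φ_{j-i}` are nonnegative: for every `k ≥ 1` and all
strictly increasing `i_1 < ⋯ < i_k`, `j_1 < ⋯ < j_k`, `det[(φ_{j_b - i_a})] ≥ 0`. -/
def TotallyPositive (φ : ℤ → ℝ) : Prop :=
  ∀ k : ℕ, 0 < k → ∀ i j : Fin k → ℤ, StrictMono i → StrictMono j →
    0 ≤ (Matrix.of fun a b : Fin k => φ (j b - i a)).det

section

open Filter Topology MeasureTheory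

/-- The factor contributed by a zero (`k = true`) or a pole (`k = false`). -/
noncomputable def edreiFactor (k : Bool) (w : ℂ) : ℂ := if k then 1 + w else (1 - w)⁻¹

/-- `u - 1` for the positive side and `u⁻¹ - 1` for the negative side. -/
noncomputable def edreiPoint (s : Bool) (u : ℂ) : ℂ := if s then u - 1 else u⁻¹ - 1

theorem edreiFactor_zero (k : Bool) : edreiFactor k 0 = 1 := by
  cases k <;> simp [edreiFactor]

theorem one_le_norm_one_sub {w : ℂ} (hw : w.re ≤ 0) : 1 ≤ ‖1 - w‖ := by
  refine le_trans ?_ (Complex.re_le_norm _)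
  simp [hw]

theorem one_sub_ne_zero_of_re_nonpos {w : ℂ} (hw : w.re ≤ 0) : 1 - w ≠ 0 := by
  rw [← norm_pos_iff]
  linarith [one_le_norm_one_sub hw]

theorem edreiPoint_re_nonpos (s : Bool) {u : ℂ} (hu : ‖u‖ = 1) : (edreiPoint s u).re ≤ 0 := by
  have h1 : u.re ≤ 1 := hu ▸ Complex.re_le_norm u
  have h2 : (u⁻¹).re ≤ 1 := by
    simpa [hu] using Complex.re_le_norm u⁻¹
  cases s
  · simpa [edreiPoint] using h2
  · simpa [edreiPoint] using h1

theorem norm_edreiPoint_le (s : Bool) {u : ℂ} (hu : ‖u‖ = 1) : ‖edreiPoint s u‖ ≤ 2 := by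
  have h1 := norm_sub_le u 1
  have h2 := norm_sub_le u⁻¹ 1
  rw [norm_inv] at h2
  cases s <;> simp [edreiPoint, hu] at * <;> linarith

theorem real_mul_re_nonpos {x : ℝ} (hx : 0 ≤ x) {z : ℂ} (hz : z.re ≤ 0) :
    ((x : ℂ) * z).re ≤ 0 := by
  simpa using mul_nonpos_of_nonneg_of_nonpos hx hz

theorem norm_edreiFactor_mul_exp_neg_sub_one_le (k : Bool) {w : ℂ} {R : ℝ} (hw : w.re ≤ 0)
    (hR : ‖w‖ ≤ R) :
    ‖edreiFactor k w * Complex.exp (-w) - 1‖ ≤ ((1 + R) * Real.exp R + 1) * ‖w‖ ^ 2 := by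
  have hR0 : 0 ≤ R := (norm_nonneg _).trans hR
  have hE : ‖Complex.exp (-w) - 1 + w‖ ≤ Real.exp R * ‖w‖ ^ 2 := by
    have := Complex.norm_exp_sub_sum_le_norm_mul_exp (-w) 2
    simp only [Finset.sum_range_succ, Finset.range_zero, Finset.sum_empty, norm_neg] at this
    norm_num at this
    rw [show Complex.exp (-w) - 1 + w = Complex.exp (-w) - (1 + -w) by ring]
    refine this.trans ?_
    rw [mul_comm]
    gcongr
  have hw2 : 0 ≤ ‖w‖ ^ 2 := by positivity
  cases k
  · have h1 := one_sub_ne_zero_of_re_nonpos hw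
    have : edreiFactor false w * Complex.exp (-w) - 1 = (1 - w)⁻¹ * (Complex.exp (-w) - 1 + w) := by
      have h3 : (1 - w)⁻¹ * (1 - w) = 1 := inv_mul_cancel₀ h1
      simp only [edreiFactor, Bool.false_eq_true, if_false]
      linear_combination h3
    rw [this, norm_mul, norm_inv]
    have h2 : ‖1 - w‖⁻¹ ≤ 1 := inv_le_one_of_one_le₀ (one_le_norm_one_sub hw)
    calc _ ≤ 1 * (Real.exp R * ‖w‖ ^ 2) := by gcongr
      _ ≤ _ := by nlinarith [mul_nonneg (mul_nonneg hR0 (Real.exp_pos R).le) hw2]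
  · have : edreiFactor true w * Complex.exp (-w) - 1
        = (1 + w) * (Complex.exp (-w) - 1 + w) - w ^ 2 := by
      simp only [edreiFactor]; simp; ring
    rw [this]
    refine (norm_sub_le _ _).trans ?_
    rw [norm_mul, norm_pow]
    have h2 : ‖1 + w‖ ≤ 1 + R := (norm_add_le _ _).trans (by simpa using hR)
    calc _ ≤ (1 + R) * (Real.exp R * ‖w‖ ^ 2) + ‖w‖ ^ 2 := by gcongr
      _ = _ := by ring

theorem hasProd_exp_mul_tprod_edreiFactor (k : Bool) {x : ℕ → ℝ} {S : ℝ} {z : ℂ}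
    (hx : ∀ i, 0 ≤ x i) (hS : HasSum x S) (hz : z.re ≤ 0) :
    HasProd (fun i => edreiFactor k (x i * z)) (Complex.exp (S * z) *
      ∏' i, (1 + (edreiFactor k (x i * z) * Complex.exp (-(x i * z)) - 1))) := by
  have h1 : HasProd (fun i => Complex.exp (x i * z)) (Complex.exp (S * z)) :=
    ((Complex.hasSum_ofReal.2 hS).mul_right z).cexp
  have hle : ∀ i, x i ≤ S := fun i => le_hasSum hS i fun j _ => hx j
  have h2 : Multipliable fun i =>
      (1 + (edreiFactor k (x i * z) * Complex.exp (-(x i * z)) - 1)) := by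
    apply multipliable_one_add_of_summable
    have hb : ∀ i, ‖edreiFactor k (x i * z) * Complex.exp (-(x i * z)) - 1‖
        ≤ ((1 + S * ‖z‖) * Real.exp (S * ‖z‖) + 1) * (S * ‖z‖ ^ 2) * x i := by
      intro i
      have hn : ‖(x i : ℂ) * z‖ = x i * ‖z‖ := by simp [abs_of_nonneg (hx i)]
      have hR : ‖(x i : ℂ) * z‖ ≤ S * ‖z‖ := by rw [hn]; gcongr; exact hle i
      have hS0 : 0 ≤ S := (hx i).trans (hle i)
      refine (norm_edreiFactor_mul_exp_neg_sub_one_le k (real_mul_re_nonpos (hx i) hz) hR).trans ?_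
      rw [hn, mul_assoc]
      gcongr
      have := mul_le_mul_of_nonneg_right (hle i) (mul_nonneg (hx i) (sq_nonneg ‖z‖))
      nlinarith
    exact (hS.summable.mul_left _).of_nonneg_of_le (fun _ => norm_nonneg _) hb
  convert h1.mul h2.hasProd using 2 with i
  rw [add_sub_cancel, mul_left_comm, ← Complex.exp_add]
  simp

theorem multipliable_edreiFactor (k : Bool) {x : ℕ → ℝ} {z : ℂ}
    (hx : ∀ i, 0 ≤ x i) (hS : Summable x) (hz : z.re ≤ 0) :
    Multipliable fun i => edreiFactor k (x i * z) :=
  (hasProd_exp_mul_tprod_edreiFactor k hx hS.hasSum hz).multipliable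

theorem tendsto_tprod_edreiFactor (k : Bool) {α : Type*} {𝓕 : Filter α} {x : α → ℕ → ℝ}
    {y : ℕ → ℝ} {S : α → ℝ} {T : ℝ} {z : α → ℂ} {z' : ℂ} {b : ℕ → ℝ}
    (hb : Summable fun i => b i ^ 2) (hx : ∀ a i, 0 ≤ x a i) (hxb : ∀ a i, x a i ≤ b i)
    (hxy : ∀ i, Tendsto (fun a => x a i) 𝓕 (𝓝 (y i))) (hy : ∀ i, 0 ≤ y i) (hys : Summable y)
    (hS : ∀ a, HasSum (x a) (S a)) (hT : Tendsto S 𝓕 (𝓝 T)) (hz : Tendsto z 𝓕 (𝓝 z'))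
    (hz0 : ∀ a, (z a).re ≤ 0) (hz2 : ∀ a, ‖z a‖ ≤ 2) (hz0' : z'.re ≤ 0) :
    Tendsto (fun a => ∏' i, edreiFactor k (x a i * z a)) 𝓕
      (𝓝 (Complex.exp ((T - ∑' i, y i : ℝ) * z') * ∏' i, edreiFactor k (y i * z'))) := by
  rw [(hasProd_exp_mul_tprod_edreiFactor k hy hys.hasSum hz0').tprod_eq, ← mul_assoc,
    ← Complex.exp_add]
  have hl : ∀ a, ∏' i, edreiFactor k (x a i * z a) = _ := fun a =>
    (hasProd_exp_mul_tprod_edreiFactor k (hx a) (hS a) (hz0 a)).tprod_eq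
  simp only [hl]
  refine Tendsto.mul ?_ ?_
  · have : ((T - ∑' i, y i : ℝ) : ℂ) * z' + ((∑' i, y i : ℝ) : ℂ) * z' = T * z' := by
      push_cast; ring
    rw [this]
    exact (Complex.continuous_exp.tendsto _).comp
      (((Complex.continuous_ofReal.tendsto _).comp hT).mul hz)
  · have hB : ∃ B, ∀ i, b i ≤ B := by
      obtain ⟨B, hB⟩ := hb.tendsto_atTop_zero.bddAbove_range
      refine ⟨1 + B, fun i => ?_⟩
      have := hB ⟨i, rfl⟩
      simp only at this
      nlinarith [sq_nonneg (b i - 1)]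
    obtain ⟨B, hB⟩ := hB
    refine tendsto_tprod_one_add_of_dominated_convergence
      (bound := fun i => ((1 + B * 2) * Real.exp (B * 2) + 1) * (4 * b i ^ 2))
      ((hb.mul_left 4).mul_left _) (fun i => ?_) (Eventually.of_forall fun a i => ?_)
    · have hw : Tendsto (fun a => (x a i : ℂ) * z a) 𝓕 (𝓝 (y i * z')) :=
        ((Complex.continuous_ofReal.tendsto _).comp (hxy i)).mul hz
      refine Tendsto.sub_const (Tendsto.mul ?_ ?_) _
      · cases k
        · simp only [edreiFactor]
          exact (tendsto_const_nhds.sub hw).inv₀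
            (one_sub_ne_zero_of_re_nonpos (real_mul_re_nonpos (hy i) hz0'))
        · simp only [edreiFactor]
          exact tendsto_const_nhds.add hw
      · exact (Complex.continuous_exp.tendsto _).comp hw.neg
    · have hn : ‖(x a i : ℂ) * z a‖ = x a i * ‖z a‖ := by simp [abs_of_nonneg (hx a i)]
      have hB0 : 0 ≤ B := (hx a i).trans ((hxb a i).trans (hB i))
      have hxB : x a i ≤ B := (hxb a i).trans (hB i)
      have hR : ‖(x a i : ℂ) * z a‖ ≤ B * 2 := by
        rw [hn]; gcongr; exact hz2 a
      refine (norm_edreiFactor_mul_exp_neg_sub_one_le k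
        (real_mul_re_nonpos (hx a i) (hz0 a)) hR).trans ?_
      gcongr
      have h0 := hx a i
      calc ‖(x a i : ℂ) * z a‖ ^ 2 ≤ (b i * 2) ^ 2 := by
            rw [hn]; gcongr
            · exact h0.trans (hxb a i)
            · exact hxb a i
            · exact hz2 a
        _ = _ := by ring

/-- The (separately convergent) infinite products of all zero and pole factors. -/
noncomputable def edreiProd (x : Bool → Bool → ℕ → ℝ) (u : ℂ) : ℂ :=
  ∏ s, ∏ k, ∏' i, edreiFactor k (x s k i * edreiPoint s u)

theorem continuous_edreiPoint_comp (s : Bool) {X : Type*} [TopologicalSpace X] {c : X → ℂ}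
    (hc : Continuous c) (hc1 : ∀ a, ‖c a‖ = 1) : Continuous fun a => edreiPoint s (c a) := by
  have h0 : ∀ a, c a ≠ 0 := fun a h => by simpa [h] using hc1 a
  cases s
  · simp only [edreiPoint, Bool.false_eq_true, if_false]
    fun_prop (disch := exact h0 _)
  · simp only [edreiPoint, if_true]
    fun_prop

theorem Summable.sq_of_nonneg {y : ℕ → ℝ} (hy : ∀ i, 0 ≤ y i) (hys : Summable y) :
    Summable fun i => y i ^ 2 := by
  refine (hys.mul_left (∑' i, y i)).of_nonneg_of_le (fun i => sq_nonneg _) fun i => ?_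
  rw [sq]
  exact mul_le_mul_of_nonneg_right (hys.le_tsum i fun j _ => hy j) (hy i)

theorem continuous_edreiProd_comp {y : Bool → Bool → ℕ → ℝ} (hy : ∀ s k i, 0 ≤ y s k i)
    (hys : ∀ s k, Summable (y s k)) {X : Type*} [TopologicalSpace X] {c : X → ℂ}
    (hc : Continuous c) (hc1 : ∀ a, ‖c a‖ = 1) : Continuous fun a => edreiProd y (c a) := by
  refine continuous_finsetProd _ fun s _ => continuous_finsetProd _ fun k _ => ?_
  refine continuous_iff_continuousAt.2 fun a => ?_
  have := tendsto_tprod_edreiFactor k (𝓕 := 𝓝 a) (x := fun _ => y s k) (y := y s k)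
    (S := fun _ => ∑' i, y s k i) (T := ∑' i, y s k i) (z := fun a => edreiPoint s (c a))
    (z' := edreiPoint s (c a)) ((hys s k).sq_of_nonneg (hy s k)) (fun _ => hy s k)
    (fun _ _ => le_rfl)
    (fun i => tendsto_const_nhds) (hy s k) (hys s k) (fun _ => (hys s k).hasSum)
    tendsto_const_nhds ((continuous_edreiPoint_comp s hc hc1).tendsto a)
    (fun a => edreiPoint_re_nonpos s (hc1 a)) (fun a => norm_edreiPoint_le s (hc1 a))
    (edreiPoint_re_nonpos s (hc1 a))
  simpa [ContinuousAt] using this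

theorem Antitone.le_div_of_hasSum {x : ℕ → ℝ} {S : ℝ} (ha : Antitone x) (hx : ∀ i, 0 ≤ x i)
    (hS : HasSum x S) (i : ℕ) : x i ≤ S / (i + 1) := by
  rw [le_div_iff₀ (by positivity)]
  calc x i * (i + 1) = ∑ j ∈ Finset.range (i + 1), x i := by simp [mul_comm]
    _ ≤ ∑ j ∈ Finset.range (i + 1), x j :=
        Finset.sum_le_sum fun j hj => ha (by simpa [Nat.lt_succ_iff] using hj)
    _ ≤ S := sum_le_hasSum _ (fun j _ => hx j) hS

theorem exists_subseq_tendsto_edreiProd {x : ℕ → Bool → Bool → ℕ → ℝ} {S : ℕ → Bool → Bool → ℝ}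
    {C : ℝ} (hx : ∀ n s k i, 0 ≤ x n s k i) (ha : ∀ n s k, Antitone (x n s k))
    (hS : ∀ n s k, HasSum (x n s k) (S n s k)) (hC : ∀ n s k, S n s k ≤ C) :
    ∃ (φ : ℕ → ℕ) (y : Bool → Bool → ℕ → ℝ) (g : Bool → ℝ), StrictMono φ ∧
      (∀ s k, Antitone (y s k)) ∧ (∀ s k, Summable (y s k)) ∧ (∀ s, 0 ≤ g s) ∧
      (∀ s k i, Tendsto (fun n => x (φ n) s k i) atTop (𝓝 (y s k i))) ∧
      ∀ u : ℂ, ‖u‖ = 1 → Tendsto (fun n => edreiProd (x (φ n)) u) atTop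
        (𝓝 (Complex.exp (∑ s, g s * edreiPoint s u) * edreiProd y u)) := by
  have hS0 : ∀ n s k, 0 ≤ S n s k := fun n s k => (hS n s k).nonneg (hx n s k)
  have hxC : ∀ n s k i, x n s k i ≤ C := fun n s k i =>
    (le_hasSum (hS n s k) i fun j _ => hx n s k j).trans (hC n s k)
  have hC0 : 0 ≤ C := (hx 0 true true 0).trans (hxC 0 true true 0)
  let X : ℕ → (Bool × Bool × Option ℕ → ℝ) := fun n p =>
    p.2.2.elim (S n p.1 p.2.1) (x n p.1 p.2.1)
  obtain ⟨Y, -, φ, hφ, hY⟩ :=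
    (isCompact_univ_pi (s := fun _ : Bool × Bool × Option ℕ => Set.Icc (0 : ℝ) C)
      fun _ => isCompact_Icc).tendsto_subseq (x := X) (by
        rintro n ⟨s, k, _ | i⟩ -
        · exact ⟨hS0 n s k, hC n s k⟩
        · exact ⟨hx n s k i, hxC n s k i⟩)
  rw [tendsto_pi_nhds] at hY
  let y : Bool → Bool → ℕ → ℝ := fun s k i => Y (s, k, some i)
  let T : Bool → Bool → ℝ := fun s k => Y (s, k, none)
  have hy : ∀ s k i, Tendsto (fun n => x (φ n) s k i) atTop (𝓝 (y s k i)) :=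
    fun s k i => hY (s, k, some i)
  have hT : ∀ s k, Tendsto (fun n => S (φ n) s k) atTop (𝓝 (T s k)) :=
    fun s k => hY (s, k, none)
  have hy0 : ∀ s k i, 0 ≤ y s k i := fun s k i => ge_of_tendsto' (hy s k i) fun n => hx _ s k i
  have hpart : ∀ s k (t : Finset ℕ), ∑ i ∈ t, y s k i ≤ T s k := fun s k t =>
    le_of_tendsto_of_tendsto' (tendsto_finsetSum t fun i _ => hy s k i) (hT s k)
      fun n => sum_le_hasSum _ (fun j _ => hx _ s k j) (hS _ s k)
  have hys : ∀ s k, Summable (y s k) := fun s k => summable_of_sum_le (hy0 s k) (hpart s k)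
  have hyT : ∀ s k, ∑' i, y s k i ≤ T s k := fun s k => (hys s k).tsum_le_of_sum_le (hpart s k)
  have hb : Summable fun i : ℕ => (C / (i + 1)) ^ 2 := by
    have h1 : Summable fun i : ℕ => C ^ 2 * (1 / ((i + 1 : ℕ) : ℝ) ^ 2) :=
      ((summable_nat_add_iff 1).2 (Real.summable_one_div_nat_pow.2 one_lt_two)).mul_left _
    refine h1.congr fun i => ?_
    push_cast
    rw [div_pow]; ring
  refine ⟨φ, y, fun s => ∑ k, (T s k - ∑' i, y s k i), hφ, fun s k i j hij => ?_, hys,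
    fun s => Finset.sum_nonneg fun k _ => sub_nonneg.2 (hyT s k), hy, fun u hu => ?_⟩
  · exact le_of_tendsto_of_tendsto' (hy s k j) (hy s k i) fun n => ha _ s k hij
  have key : Tendsto (fun n => edreiProd (x (φ n)) u) atTop (𝓝 (∏ s, ∏ k,
      (Complex.exp ((T s k - ∑' i, y s k i : ℝ) * edreiPoint s u) *
        ∏' i, edreiFactor k (y s k i * edreiPoint s u)))) := by
    refine tendsto_finsetProd _ fun s _ => tendsto_finsetProd _ fun k _ => ?_
    refine tendsto_tprod_edreiFactor k hb (fun n => hx (φ n) s k) (fun n i => ?_) (hy s k)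
      (hy0 s k) (hys s k) (fun n => hS (φ n) s k) (hT s k) tendsto_const_nhds
      (fun _ => edreiPoint_re_nonpos s hu) (fun _ => norm_edreiPoint_le s hu)
      (edreiPoint_re_nonpos s hu)
    refine ((ha (φ n) s k).le_div_of_hasSum (hx _ s k) (hS _ s k) i).trans ?_
    gcongr
    exact hC _ s k
  convert key using 2
  simp only [Finset.prod_mul_distrib, ← Complex.exp_sum, edreiProd, ← Finset.sum_mul]
  push_cast
  rfl

theorem edreiProd_eq_tprod {x : Bool → Bool → ℕ → ℝ} (hx : ∀ s k i, 0 ≤ x s k i)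
    (hxs : ∀ s k, Summable (x s k)) {u : ℂ} (hu : ‖u‖ = 1) :
    HasProd (fun i => ((1 + (x true true i : ℂ) * (u - 1)) *
      (1 + (x false true i : ℂ) * (u⁻¹ - 1))) / ((1 - (x true false i : ℂ) * (u - 1)) *
        (1 - (x false false i : ℂ) * (u⁻¹ - 1)))) (edreiProd x u) := by
  have h := fun s k =>
    (multipliable_edreiFactor k (hx s k) (hxs s k) (edreiPoint_re_nonpos s hu)).hasProd
  convert ((h true true).mul (h true false)).mul ((h false true).mul (h false false)) using 1
  · ext i
    simp [edreiFactor, edreiPoint, div_eq_mul_inv]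
    ring
  · simp [edreiProd]

theorem hasSum_prod_apply_of_summable_norm {X 𝕜 : Type*} [NormedField 𝕜] [CompleteSpace 𝕜]
    {N : ℕ} (f : Fin N → X → 𝕜) (hf : ∀ i, Summable fun x => ‖f i x‖) :
    (Summable fun l : Fin N → X => ‖∏ i, f i (l i)‖) ∧
      HasSum (fun l : Fin N → X => ∏ i, f i (l i)) (∏ i, ∑' x, f i x) := by
  induction N with
  | zero =>
    exact ⟨(hasSum_fintype _).summable, by simp⟩
  | succ N ih =>
    obtain ⟨h1, h2⟩ := ih (fun i => f i.succ) (fun i => hf i.succ)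
    let e := Fin.consEquiv (fun _ : Fin (N + 1) => X)
    have hcomp : (fun l : Fin (N + 1) → X => ∏ i, f i (l i)) ∘ e =
        fun p : X × (Fin N → X) => f 0 p.1 * ∏ i, f i.succ (p.2 i) := by
      ext p
      simp [e, Fin.prod_univ_succ, Fin.consEquiv]
    constructor
    · rw [← e.summable_iff]
      exact (Summable.mul_norm (hf 0) h1).congr fun p => by rw [← congrFun hcomp p]; rfl
    · rw [← e.hasSum_iff, hcomp, Fin.prod_univ_succ, ← h2.tsum_eq,
        tsum_mul_tsum_of_summable_norm (hf 0) h1]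
      exact (summable_mul_of_summable_norm (hf 0) h1).hasSum

/-- A Cauchy–Binet formula for products of a finite-by-infinite and an infinite-by-finite matrix. -/
theorem hasSum_det_mul_det {X 𝕜 : Type*} [NormedField 𝕜] [CompleteSpace 𝕜] {N : ℕ}
    (A : Fin N → X → 𝕜) (B : X → Fin N → 𝕜) (h : ∀ j k, Summable fun x => ‖A j x * B x k‖) :
    HasSum (fun l : Fin N → X => (Matrix.of fun i j => A j (l i)).det *
        (Matrix.of fun i k => B (l i) k).det)
      (N.factorial * (Matrix.of fun j k => ∑' x, A j x * B x k).det) := by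
  set M : Matrix (Fin N) (Fin N) 𝕜 := Matrix.of fun j k => ∑' x, A j x * B x k with hM
  have hterm : ∀ σ τ : Equiv.Perm (Fin N),
      HasSum (fun l : Fin N → X => ((σ.sign : ℤ) : 𝕜) * ((τ.sign : ℤ) : 𝕜) *
        ∏ i, (A (σ i) (l i) * B (l i) (τ i)))
        (((σ.sign : ℤ) : 𝕜) * ((τ.sign : ℤ) : 𝕜) * ∏ i, M (σ i) (τ i)) := fun σ τ =>
    ((hasSum_prod_apply_of_summable_norm (fun i x => A (σ i) x * B x (τ i))
      fun i => h _ _).2).mul_left _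
  have hsum := hasSum_sum (s := Finset.univ) fun σ _ =>
    hasSum_sum (s := Finset.univ) fun τ _ => hterm σ τ
  convert hsum using 1
  · ext l
    rw [← Matrix.det_transpose, Matrix.det_apply', ← Matrix.det_transpose, Matrix.det_apply',
      Finset.sum_mul_sum]
    refine Finset.sum_congr rfl fun σ _ => Finset.sum_congr rfl fun τ _ => ?_
    simp only [Matrix.transpose_apply, Matrix.of_apply, Finset.prod_mul_distrib]
    ring
  · have : ∀ σ : Equiv.Perm (Fin N), ∑ τ : Equiv.Perm (Fin N),
        ((σ.sign : ℤ) : 𝕜) * ((τ.sign : ℤ) : 𝕜) * ∏ i, M (σ i) (τ i) = M.det := by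
      intro σ
      have h1 : (M.submatrix σ id).det = ((σ.sign : ℤ) : 𝕜) * M.det := Matrix.det_permute σ M
      have h2 : ((σ.sign : ℤ) : 𝕜) * ((σ.sign : ℤ) : 𝕜) = 1 := by
        rcases Int.units_eq_one_or σ.sign with h | h <;> simp [h]
      simp only [mul_assoc]
      rw [← Finset.mul_sum]
      have h3 : (M.submatrix σ id).det
          = ∑ τ : Equiv.Perm (Fin N), ((τ.sign : ℤ) : 𝕜) * ∏ i, M (σ i) (τ i) := by
        rw [← Matrix.det_transpose, Matrix.det_apply']
        rfl
      rw [← h3, h1, ← mul_assoc, h2, one_mul]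
    simp [this, Fintype.card_perm]

theorem det_mul_det_nonneg_of_strictMono {N : ℕ} {P Q : ℤ → Fin N → ℝ}
    (hP : ∀ l : Fin N → ℤ, StrictMono l → 0 ≤ (Matrix.of fun i j => P (l i) j).det)
    (hQ : ∀ l : Fin N → ℤ, StrictMono l → 0 ≤ (Matrix.of fun i j => Q (l i) j).det)
    (l : Fin N → ℤ) :
    0 ≤ (Matrix.of fun i j => P (l i) j).det * (Matrix.of fun i j => Q (l i) j).det := by
  by_cases hl : Function.Injective l
  · have hmono : StrictMono (l ∘ Tuple.sort l) :=
      (Tuple.monotone_sort l).strictMono_of_injective (hl.comp (Tuple.sort l).injective)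
    have h1 := hP _ hmono
    have h2 := hQ _ hmono
    have e : ∀ R : ℤ → Fin N → ℝ, (Matrix.of fun i j => R ((l ∘ Tuple.sort l) i) j).det =
        (((Tuple.sort l).sign : ℤ) : ℝ) * (Matrix.of fun i j => R (l i) j).det := fun R =>
      Matrix.det_permute (Tuple.sort l) (Matrix.of fun i j => R (l i) j)
    rw [e] at h1 h2
    have := mul_nonneg h1 h2
    rcases Int.units_eq_one_or (Tuple.sort l).sign with h | h <;> simpa [h] using this
  · obtain ⟨a, b, hab, hne⟩ := Function.not_injective_iff.1 hl
    rw [Matrix.det_zero_of_row_eq (M := Matrix.of fun i j => P (l i) j) hne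
      (by ext j; simp [hab]), zero_mul]

theorem TotallyPositive.nonneg {φ : ℤ → ℝ} (h : TotallyPositive φ) (n : ℤ) : 0 ≤ φ n := by
  have := h 1 one_pos (fun _ => 0) (fun _ => n) (Subsingleton.strictMono _)
    (Subsingleton.strictMono _)
  simpa using this

theorem TotallyPositive.det_nonneg {φ : ℤ → ℝ} (h : TotallyPositive φ) {k : ℕ} {i j : Fin k → ℤ}
    (hi : StrictMono i) (hj : StrictMono j) :
    0 ≤ (Matrix.of fun a b : Fin k => φ (j b - i a)).det := by
  rcases k.eq_zero_or_pos with rfl | hk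
  · simp
  · exact h k hk i j hi hj

theorem TotallyPositive.convolution {φ ψ : ℤ → ℝ} (hφ : TotallyPositive φ)
    (hψ : TotallyPositive ψ) (hφs : Summable φ) (hψs : Summable ψ) :
    TotallyPositive fun n => ∑' m, φ m * ψ (n - m) := by
  intro k _ i j hi hj
  have hbd : ∀ x, ψ x ≤ ∑' y, ψ y := fun x => hψs.le_tsum x fun _ _ => hψ.nonneg _
  have hs : ∀ a b, Summable fun x => ‖φ (x - i a) * ψ (j b - x)‖ := fun a b => by
    refine (((Equiv.subRight (i a)).summable_iff.2 hφs).mul_right (∑' y, ψ y)).of_nonneg_of_le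
      (fun _ => norm_nonneg _) fun x => ?_
    rw [Real.norm_of_nonneg (mul_nonneg (hφ.nonneg _) (hψ.nonneg _))]
    exact mul_le_mul_of_nonneg_left (hbd _) (hφ.nonneg _)
  have key := hasSum_det_mul_det (fun a x => φ (x - i a)) (fun x b => ψ (j b - x)) hs
  have hnn := key.nonneg fun l => by
    refine det_mul_det_nonneg_of_strictMono (P := fun x a => φ (x - i a))
      (Q := fun x b => ψ (j b - x)) (fun l hl => ?_) (fun l hl => hψ.det_nonneg hl hj) l
    rw [← Matrix.det_transpose]
    exact hφ.det_nonneg hi hl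
  have hpos : (0 : ℝ) < k.factorial := by positivity
  have hM : (Matrix.of fun a b => ∑' m, φ m * ψ (j b - i a - m)) =
      Matrix.of fun a b => ∑' x, φ (x - i a) * ψ (j b - x) := by
    ext a b
    simp only [Matrix.of_apply]
    rw [← (Equiv.subRight (i a)).tsum_eq]
    simp
  rw [hM]
  exact nonneg_of_mul_nonneg_right hnn hpos

theorem TotallyPositive.neg {φ : ℤ → ℝ} (hφ : TotallyPositive φ) :
    TotallyPositive fun n => φ (-n) := by
  intro k _ i j hi hj
  rw [← Matrix.det_transpose]
  have hM : (Matrix.of fun a b => φ (-(j b - i a))).transpose =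
      Matrix.of fun b a => φ (i a - j b) := by
    ext a b
    simp
  rw [hM]
  exact hφ.det_nonneg hj hi

theorem totallyPositive_of_tendsto {φ : ℕ → ℤ → ℝ} {ψ : ℤ → ℝ} (hφ : ∀ n, TotallyPositive (φ n))
    (h : ∀ m, Tendsto (fun n => φ n m) atTop (𝓝 (ψ m))) : TotallyPositive ψ := by
  intro k hk i j hi hj
  refine ge_of_tendsto' (x := atTop) ?_ fun n => hφ n k hk i j hi hj
  simp only [Matrix.det_apply]
  refine tendsto_finsetSum _ fun σ _ => Tendsto.const_smul (tendsto_finsetProd _ fun a _ => ?_) _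
  exact h _

theorem Matrix.det_succ_of_column_zero {R : Type*} [CommRing R] {n : ℕ}
    (M : Matrix (Fin (n + 1)) (Fin (n + 1)) R) (h : ∀ a : Fin n, M a.succ 0 = 0) :
    M.det = M 0 0 * (M.submatrix Fin.succ Fin.succ).det := by
  rw [Matrix.det_succ_column_zero, Fin.sum_univ_succ]
  simp [h, Fin.succAbove_zero]

theorem Matrix.det_succ_of_row_zero {R : Type*} [CommRing R] {n : ℕ}
    (M : Matrix (Fin (n + 1)) (Fin (n + 1)) R) (h : ∀ a : Fin n, M 0 a.succ = 0) :
    M.det = M 0 0 * (M.submatrix Fin.succ Fin.succ).det := by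
  rw [← Matrix.det_transpose, Matrix.det_succ_of_column_zero _ h, ← Matrix.det_transpose]
  rfl

/-- The coefficients of `p + q u`. -/
noncomputable def twoPoint (p q : ℝ) (n : ℤ) : ℝ := if n = 0 then p else if n = 1 then q else 0

theorem totallyPositive_twoPoint {p q : ℝ} (hp : 0 ≤ p) (hq : 0 ≤ q) :
    TotallyPositive (twoPoint p q) := by
  intro k _
  induction k with
  | zero => intro i j _ _; simp
  | succ k ih =>
    intro i j hi hj
    have ih' : 0 ≤ ((Matrix.of fun a b => twoPoint p q (j b - i a)).submatrix
        (Fin.succ (n := k)) Fin.succ).det := by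
      rcases k.eq_zero_or_pos with rfl | hk
      · simp
      · exact ih hk (fun a => i a.succ) (fun a => j a.succ)
          (hi.comp Fin.strictMono_succ) (hj.comp Fin.strictMono_succ)
    have hi0 : ∀ a : Fin k, i 0 < i a.succ := fun a => hi (Fin.succ_pos a)
    have hj0 : ∀ a : Fin k, j 0 < j a.succ := fun a => hj (Fin.succ_pos a)
    have h00 : 0 ≤ twoPoint p q (j 0 - i 0) := by unfold twoPoint; split_ifs <;> simp [*]
    by_cases h : j 0 - i 0 ≤ 0
    · rw [Matrix.det_succ_of_column_zero]
      · exact mul_nonneg h00 ih'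
      · intro a
        have := hi0 a
        simp only [Matrix.of_apply, twoPoint]
        rw [if_neg (by omega), if_neg (by omega)]
    · rw [Matrix.det_succ_of_row_zero]
      · exact mul_nonneg h00 ih'
      · intro a
        have := hj0 a
        simp only [Matrix.of_apply, twoPoint]
        rw [if_neg (by omega), if_neg (by omega)]

/-- The coefficients of `c / (1 - r u)`. -/
noncomputable def geometricSeq (c r : ℝ) (n : ℤ) : ℝ := if 0 ≤ n then c * r ^ n.toNat else 0

theorem totallyPositive_geometricSeq {c r : ℝ} (hc : 0 ≤ c) (hr : 0 ≤ r) :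
    TotallyPositive (geometricSeq c r) := by
  intro k _
  induction k with
  | zero => intro i j _ _; simp
  | succ k ih =>
    intro i j hi hj
    have ih' : 0 ≤ ((Matrix.of fun a b => geometricSeq c r (j b - i a)).submatrix
        (Fin.succ (n := k)) Fin.succ).det := by
      rcases k.eq_zero_or_pos with rfl | hk
      · simp
      · exact ih hk (fun a => i a.succ) (fun a => j a.succ)
          (hi.comp Fin.strictMono_succ) (hj.comp Fin.strictMono_succ)
    have h00 : 0 ≤ geometricSeq c r (j 0 - i 0) := by
      unfold geometricSeq; split_ifs <;> positivity
    by_cases h : ∀ a : Fin k, j 0 < i a.succ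
    · rw [Matrix.det_succ_of_column_zero]
      · exact mul_nonneg h00 ih'
      · intro a
        have := h a
        simp only [Matrix.of_apply, geometricSeq]
        rw [if_neg (by omega)]
    · push Not at h
      obtain ⟨a, ha⟩ := h
      have hia : i 0 < i a.succ := hi (Fin.succ_pos a)
      rw [← Matrix.det_updateRow_add_smul_self _ (Fin.succ_ne_zero a).symm
        (-(r ^ (i a.succ - i 0).toNat)), Matrix.det_eq_zero_of_row_eq_zero 0]
      intro b
      have hjb : j 0 ≤ j b := hj.monotone (Fin.zero_le b)
      simp only [Matrix.updateRow_self, Matrix.of_apply, Pi.add_apply, Pi.smul_apply, smul_eq_mul,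
        geometricSeq]
      rw [if_pos (by omega), if_pos (by omega), show (j b - i 0).toNat =
        (i a.succ - i 0).toNat + (j b - i a.succ).toNat by omega, pow_add]
      ring

theorem norm_exp_ofReal_mul_I_zpow (θ : ℝ) (n : ℤ) :
    ‖Complex.exp (θ * Complex.I) ^ n‖ = 1 := by
  rw [norm_zpow, Complex.norm_exp_ofReal_mul_I, one_zpow]

theorem integral_exp_zpow (k : ℤ) :
    ∫ θ in Set.Ioc (-Real.pi) Real.pi, Complex.exp (θ * Complex.I) ^ k =
      if k = 0 then 2 * (Real.pi : ℂ) else 0 := by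
  rw [← intervalIntegral.integral_of_le (by linarith [Real.pi_pos])]
  split_ifs with hk
  · subst hk
    simp
    ring
  · have hc : (k : ℂ) * Complex.I ≠ 0 := mul_ne_zero (by exact_mod_cast hk) Complex.I_ne_zero
    have := integral_exp_mul_complex (a := -Real.pi) (b := Real.pi) hc
    have h2 : ∀ θ : ℝ, Complex.exp (θ * Complex.I) ^ k = Complex.exp (k * Complex.I * θ) := by
      intro θ
      rw [← Complex.exp_int_mul]
      ring_nf
    simp only [h2]
    rw [this, div_eq_zero_iff, sub_eq_zero]
    left
    rw [Complex.exp_eq_exp_iff_exists_int]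
    exact ⟨k, by push_cast; ring⟩

theorem continuous_exp_zpow (k : ℤ) :
    Continuous fun θ : ℝ => Complex.exp (θ * Complex.I) ^ k := by
  refine Continuous.zpow₀ (by fun_prop) k fun θ => Or.inl (Complex.exp_ne_zero _)

theorem integral_generating_mul_exp {φ : ℤ → ℝ} (hφ : Summable fun n => ‖φ n‖) {F : ℂ → ℂ}
    (hF : ∀ u : ℂ, ‖u‖ = 1 → HasSum (fun n : ℤ => (φ n : ℂ) * u ^ n) (F u)) (n : ℤ) :
    ∫ θ in Set.Ioc (-Real.pi) Real.pi,
      F (Complex.exp (θ * Complex.I)) * Complex.exp (θ * Complex.I) ^ (-n) =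
      2 * (Real.pi : ℂ) * φ n := by
  let f : ℤ → ℝ → ℂ := fun m θ => (φ m : ℂ) * Complex.exp (θ * Complex.I) ^ (m - n)
  have hnorm : ∀ m θ, ‖f m θ‖ = ‖φ m‖ := fun m θ => by
    simp only [f, norm_mul, norm_exp_ofReal_mul_I_zpow, mul_one, Complex.norm_real]
  have hInt : ∀ m, Integrable (f m) (volume.restrict (Set.Ioc (-Real.pi) Real.pi)) := fun m =>
    ((continuous_const.mul (continuous_exp_zpow (m - n))).integrableOn_Icc).mono_set
      Set.Ioc_subset_Icc_self
  have h1 := hasSum_integral_of_summable_integral_norm hInt (by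
    simp only [hnorm]
    simpa using hφ.mul_left _)
  have h2 : ∀ m, ∫ θ in Set.Ioc (-Real.pi) Real.pi, f m θ =
      if m = n then 2 * (Real.pi : ℂ) * φ n else 0 := fun m => by
    simp only [f, integral_const_mul, integral_exp_zpow, sub_eq_zero]
    split_ifs with h
    · rw [h]; ring
    · simp
  simp only [h2] at h1
  rw [← h1.unique (hasSum_ite_eq n _)]
  refine setIntegral_congr_fun measurableSet_Ioc fun θ _ => ?_
  have h3 := (hF _ (Complex.norm_exp_ofReal_mul_I θ)).mul_right
    (Complex.exp (θ * Complex.I) ^ (-n))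
  rw [← h3.tsum_eq]
  refine tsum_congr fun m => ?_
  simp only [f]
  rw [mul_assoc, ← zpow_add₀ (Complex.exp_ne_zero _), sub_eq_add_neg]

/-- `F` agrees on the unit circle with the generating function of a totally positive probability
distribution on `ℤ`. -/
def IsTPGenerating (F : ℂ → ℂ) : Prop :=
  ∃ φ : ℤ → ℝ, TotallyPositive φ ∧ HasSum φ 1 ∧
    ∀ u : ℂ, ‖u‖ = 1 → HasSum (fun n : ℤ => (φ n : ℂ) * u ^ n) (F u)

theorem IsTPGenerating.congr {F G : ℂ → ℂ} (hF : IsTPGenerating F)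
    (h : ∀ u : ℂ, ‖u‖ = 1 → F u = G u) : IsTPGenerating G := by
  obtain ⟨φ, h1, h2, h3⟩ := hF
  exact ⟨φ, h1, h2, fun u hu => h u hu ▸ h3 u hu⟩

theorem hasSum_convolution {φ ψ : ℤ → ℝ} {a b : ℂ} {u : ℂ} (hu : ‖u‖ = 1)
    (hφ : Summable fun n => ‖φ n‖) (hψ : Summable fun n => ‖ψ n‖)
    (ha : HasSum (fun n : ℤ => (φ n : ℂ) * u ^ n) a)
    (hb : HasSum (fun n : ℤ => (ψ n : ℂ) * u ^ n) b) :
    HasSum (fun n : ℤ => ((∑' m, φ m * ψ (n - m) : ℝ) : ℂ) * u ^ n) (a * b) := by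
  have hu0 : u ≠ 0 := fun h => by simp [h] at hu
  have hn : ∀ χ : ℤ → ℝ, (Summable fun n => ‖χ n‖) → Summable fun n : ℤ => ‖(χ n : ℂ) * u ^ n‖ :=
    fun χ h => h.congr fun n => by simp [hu]
  have h1 : HasSum (fun p : ℤ × ℤ => ((φ p.1 : ℂ) * u ^ p.1) * ((ψ p.2 : ℂ) * u ^ p.2))
      (a * b) := by
    rw [← ha.tsum_eq, ← hb.tsum_eq, tsum_mul_tsum_of_summable_norm (hn φ hφ) (hn ψ hψ)]
    exact (summable_mul_of_summable_norm (hn φ hφ) (hn ψ hψ)).hasSum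
  let e : ℤ × ℤ ≃ ℤ × ℤ :=
    ⟨fun p => (p.2, p.1 - p.2), fun p => (p.1 + p.2, p.1), fun p => by simp, fun p => by simp⟩
  rw [← e.hasSum_iff] at h1
  refine h1.prod_fiberwise fun n => ?_
  have hs : Summable fun m => φ m * ψ (n - m) := by
    have hbd : ∀ x, ‖ψ x‖ ≤ ∑' y, ‖ψ y‖ := fun x => hψ.le_tsum x fun _ _ => norm_nonneg _
    refine Summable.of_norm ((hφ.mul_right (∑' y, ‖ψ y‖)).of_nonneg_of_le
      (fun _ => norm_nonneg _) fun x => ?_)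
    rw [norm_mul]
    exact mul_le_mul_of_nonneg_left (hbd _) (norm_nonneg _)
  refine ((Complex.hasSum_ofReal.2 hs.hasSum).mul_right (u ^ n)).congr_fun ?_
  intro m
  simp only [Function.comp, e, Equiv.coe_fn_mk]
  rw [mul_mul_mul_comm, ← zpow_add₀ hu0]
  simp

theorem HasSum.ofReal_mul_one_zpow {φ : ℤ → ℝ} {a : ℝ} (h : HasSum φ a) :
    HasSum (fun n : ℤ => (φ n : ℂ) * 1 ^ n) (a : ℂ) := by
  simpa using Complex.hasSum_ofReal.2 h

theorem TotallyPositive.summable_norm {φ : ℤ → ℝ} (hφ : TotallyPositive φ) (h : Summable φ) :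
    Summable fun n => ‖φ n‖ :=
  h.congr fun n => (Real.norm_of_nonneg (hφ.nonneg n)).symm

theorem IsTPGenerating.mul {F G : ℂ → ℂ} (hF : IsTPGenerating F) (hG : IsTPGenerating G) :
    IsTPGenerating fun u => F u * G u := by
  obtain ⟨φ, h1, h2, h3⟩ := hF
  obtain ⟨ψ, k1, k2, k3⟩ := hG
  have hφn := h1.summable_norm h2.summable
  have hψn := k1.summable_norm k2.summable
  refine ⟨fun n => ∑' m, φ m * ψ (n - m), h1.convolution k1 h2.summable k2.summable, ?_,
    fun u hu => hasSum_convolution hu hφn hψn (h3 u hu) (k3 u hu)⟩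
  have := hasSum_convolution (u := 1) (by simp) hφn hψn h2.ofReal_mul_one_zpow
    k2.ofReal_mul_one_zpow
  rw [← Complex.hasSum_ofReal]
  simpa using this

theorem IsTPGenerating.inv {F : ℂ → ℂ} (hF : IsTPGenerating F) :
    IsTPGenerating fun u => F u⁻¹ := by
  obtain ⟨φ, h1, h2, h3⟩ := hF
  refine ⟨fun n => φ (-n), h1.neg, (Equiv.neg ℤ).hasSum_iff.2 h2, fun u hu => ?_⟩
  have := (Equiv.neg ℤ).hasSum_iff.2 (h3 u⁻¹ (by simp [hu]))
  simpa [Function.comp_def] using this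

theorem isTPGenerating_one_add {b : ℝ} (hb0 : 0 ≤ b) (hb1 : b ≤ 1) :
    IsTPGenerating fun u => 1 + b * (u - 1) := by
  have hsupp : ∀ n ∉ ({0, 1} : Finset ℤ), twoPoint (1 - b) b n = 0 := fun n hn => by
    simp only [Finset.mem_insert, Finset.mem_singleton, not_or] at hn
    simp [twoPoint, hn]
  refine ⟨twoPoint (1 - b) b, totallyPositive_twoPoint (by linarith) hb0, ?_, fun u _ => ?_⟩
  · have : HasSum (twoPoint (1 - b) b) _ := hasSum_sum_of_ne_finset_zero hsupp
    simpa [twoPoint] using this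
  · have : HasSum (fun n : ℤ => (twoPoint (1 - b) b n : ℂ) * u ^ n) _ :=
      hasSum_sum_of_ne_finset_zero (s := {0, 1}) (fun n hn => by simp [hsupp n hn])
    rw [Finset.sum_pair zero_ne_one] at this
    have h2 : (1 : ℂ) + b * (u - 1) = (twoPoint (1 - b) b 0 : ℂ) * u ^ (0 : ℤ) +
        (twoPoint (1 - b) b 1 : ℂ) * u ^ (1 : ℤ) := by
      simp [twoPoint]
      ring
    simp only [h2]
    exact this

theorem isTPGenerating_inv_one_sub {a : ℝ} (ha : 0 ≤ a) :
    IsTPGenerating fun u => (1 - a * (u - 1))⁻¹ := by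
  have ha1 : (0 : ℝ) < 1 + a := by linarith
  have key : ∀ u : ℂ, ‖u‖ = 1 → HasSum
      (fun n : ℤ => (geometricSeq (1 + a)⁻¹ (a / (1 + a)) n : ℂ) * u ^ n)
      (1 - a * (u - 1))⁻¹ := by
    intro u hu
    have hinj : Function.Injective (Nat.cast : ℕ → ℤ) := Nat.cast_injective
    rw [← hinj.hasSum_iff]
    · have hr : ‖(a / (1 + a) : ℝ) * u‖ < 1 := by
        rw [norm_mul, hu, mul_one, Complex.norm_real, Real.norm_of_nonneg (by positivity),
          div_lt_one ha1]
        linarith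
      have hv : (1 - a * (u - 1))⁻¹ =
          (((1 + a)⁻¹ : ℝ) : ℂ) * (1 - (a / (1 + a) : ℝ) * u)⁻¹ := by
        rw [Complex.ofReal_inv, ← mul_inv]
        congr 1
        have : (1 + a : ℂ) ≠ 0 := by exact_mod_cast ha1.ne'
        push_cast
        field_simp
        ring
      rw [hv]
      refine ((hasSum_geometric_of_norm_lt_one hr).mul_left _).congr_fun fun n => ?_
      simp [geometricSeq]
      ring
    · intro n hn
      have : n < 0 := by
        by_contra h
        exact hn ⟨n.toNat, by simp; omega⟩
      simp [geometricSeq, this]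
  refine ⟨_, totallyPositive_geometricSeq (by positivity) (by positivity), ?_, key⟩
  rw [← Complex.hasSum_ofReal]
  simpa using key 1 (by simp)

theorem isTPGenerating_edreiFactor (s k : Bool) {x : ℝ} (hx : 0 ≤ x) (hx1 : k = true → x ≤ 1) :
    IsTPGenerating fun u => edreiFactor k (x * edreiPoint s u) := by
  have h : IsTPGenerating fun u => edreiFactor k (x * edreiPoint true u) := by
    cases k
    · exact (isTPGenerating_inv_one_sub hx).congr fun u _ => by simp [edreiFactor, edreiPoint]
    · exact (isTPGenerating_one_add hx (hx1 rfl)).congr fun u _ => by simp [edreiFactor, edreiPoint]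
  cases s
  · exact h.inv.congr fun u _ => by simp [edreiPoint]
  · exact h

theorem isTPGenerating_one : IsTPGenerating fun _ => 1 :=
  (isTPGenerating_one_add le_rfl zero_le_one).congr fun u _ => by simp

theorem IsTPGenerating.prod {ι : Type*} (t : Finset ι) {F : ι → ℂ → ℂ}
    (hF : ∀ i ∈ t, IsTPGenerating (F i)) : IsTPGenerating fun u => ∏ i ∈ t, F i u := by
  classical
  induction t using Finset.induction_on with
  | empty => simpa using isTPGenerating_one
  | insert i t hi ih =>
    simp only [Finset.prod_insert hi]
    exact (hF i (Finset.mem_insert_self _ _)).mul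
      (ih fun j hj => hF j (Finset.mem_insert_of_mem hj))

theorem IsTPGenerating.norm_le_one {F : ℂ → ℂ} (hF : IsTPGenerating F) {u : ℂ} (hu : ‖u‖ = 1) :
    ‖F u‖ ≤ 1 := by
  obtain ⟨φ, h1, h2, h3⟩ := hF
  rw [← (h3 u hu).tsum_eq]
  refine tsum_of_norm_bounded h2 fun n => ?_
  simp [hu, abs_of_nonneg (h1.nonneg n)]

theorem totallyPositive_of_tendsto_generating {F : ℕ → ℂ → ℂ} {G : ℂ → ℂ} {φ : ℤ → ℝ}
    (hF : ∀ n, IsTPGenerating (F n))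
    (hlim : ∀ u : ℂ, ‖u‖ = 1 → Tendsto (fun n => F n u) atTop (𝓝 (G u)))
    (hφ : Summable fun n => ‖φ n‖)
    (hG : ∀ u : ℂ, ‖u‖ = 1 → HasSum (fun n : ℤ => (φ n : ℂ) * u ^ n) (G u)) :
    TotallyPositive φ := by
  have hF' := hF
  choose ψ h1 h2 h3 using hF
  refine totallyPositive_of_tendsto h1 fun m => ?_
  have hI := fun n => integral_generating_mul_exp ((h1 n).summable_norm (h2 n).summable) (h3 n) m
  have hJ := integral_generating_mul_exp hφ hG m
  have hcont : ∀ n, Continuous fun θ : ℝ => F n (Complex.exp (θ * Complex.I)) := fun n => by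
    have : (fun θ : ℝ => F n (Complex.exp (θ * Complex.I))) =
        fun θ : ℝ => ∑' k : ℤ, (ψ n k : ℂ) * Complex.exp (θ * Complex.I) ^ k := by
      ext θ
      exact (h3 n _ (Complex.norm_exp_ofReal_mul_I θ)).tsum_eq.symm
    rw [this]
    refine continuous_tsum (fun k => continuous_const.mul (continuous_exp_zpow k))
      ((h1 n).summable_norm (h2 n).summable) fun k θ => ?_
    rw [norm_mul, norm_exp_ofReal_mul_I_zpow, mul_one, Complex.norm_real]
  have ht : Tendsto (fun n => 2 * (Real.pi : ℂ) * (ψ n m : ℂ)) atTop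
      (𝓝 (2 * (Real.pi : ℂ) * (φ m : ℂ))) := by
    simp only [← hI, ← hJ]
    refine tendsto_integral_of_dominated_convergence (fun _ => 1) (fun n => ?_) (by simp)
      (fun n => Eventually.of_forall fun θ => ?_) (Eventually.of_forall fun θ => ?_)
    · exact ((hcont n).mul (continuous_exp_zpow _)).aestronglyMeasurable
    · rw [norm_mul, norm_exp_ofReal_mul_I_zpow, mul_one]
      exact (hF' n).norm_le_one (Complex.norm_exp_ofReal_mul_I θ)
    · exact (hlim _ (Complex.norm_exp_ofReal_mul_I θ)).mul_const _
  have hpi : (2 * (Real.pi : ℂ)) ≠ 0 := by simp [Real.pi_ne_zero]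
  have ht2 := ht.const_mul (2 * (Real.pi : ℂ))⁻¹
  simp only [inv_mul_cancel_left₀ hpi] at ht2
  simpa [Function.comp_def] using (Complex.continuous_re.tendsto _).comp ht2

theorem totallyPositive_of_edrei_form {φ : ℤ → ℝ} {x : Bool → Bool → ℕ → ℝ} {g : Bool → ℝ}
    (hx : ∀ s k i, 0 ≤ x s k i) (hxs : ∀ s k, Summable (x s k)) (hx1 : ∀ s i, x s true i ≤ 1)
    (hg : ∀ s, 0 ≤ g s) (hφ : Summable fun n => ‖φ n‖)
    (h : ∀ u : ℂ, ‖u‖ = 1 → HasSum (fun n : ℤ => (φ n : ℂ) * u ^ n)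
      (Complex.exp (∑ s, g s * edreiPoint s u) * edreiProd x u)) :
    TotallyPositive φ := by
  refine totallyPositive_of_tendsto_generating
    (F := fun n u => (∏ s, (∏ _i ∈ Finset.range n,
        edreiFactor false ((g s / n : ℝ) * edreiPoint s u))) *
      ∏ s, ∏ k, ∏ i ∈ Finset.range n, edreiFactor k (x s k i * edreiPoint s u))
    (fun n => ?_) (fun u hu => ?_) hφ h
  · refine (IsTPGenerating.prod _ fun s _ => IsTPGenerating.prod _ fun i _ =>
      isTPGenerating_edreiFactor s false (div_nonneg (hg s) n.cast_nonneg) (by simp)).mul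
      (IsTPGenerating.prod _ fun s _ => IsTPGenerating.prod _ fun k _ =>
        IsTPGenerating.prod _ fun i _ =>
      isTPGenerating_edreiFactor s k (hx s k i) (by rintro rfl; exact hx1 s i))
  · refine Tendsto.mul ?_ ?_
    · rw [Complex.exp_sum]
      refine tendsto_finsetProd _ fun s _ => ?_
      have h1 := (Complex.tendsto_one_add_div_pow_exp (-(g s * edreiPoint s u))).inv₀
        (Complex.exp_ne_zero _)
      rw [← Complex.exp_neg, neg_neg] at h1
      refine h1.congr fun n => ?_
      simp [edreiFactor, sub_eq_add_neg]
      ring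
    · refine tendsto_finsetProd _ fun s _ => tendsto_finsetProd _ fun k _ => ?_
      exact (multipliable_edreiFactor k (hx s k) (hxs s k)
        (edreiPoint_re_nonpos s hu)).hasProd.tendsto_prod_nat

theorem TotallyPositive.two_mul_le {φ : ℤ → ℝ} (h : TotallyPositive φ) {p q x y : ℤ}
    (hpq : p < q) (hpx : p < x) (hsum : p + y = q + x) : φ p * φ y ≤ φ q * φ x := by
  have := h.det_nonneg (k := 2) (i := ![0, x - p]) (j := ![x, y])
    (by intro a b hab; fin_cases a <;> fin_cases b <;> simp_all)
    (by intro a b hab; fin_cases a <;> fin_cases b <;> simp_all; omega)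
  rw [Matrix.det_fin_two] at this
  simp at this
  have e : y - (x - p) = q := by omega
  rw [e] at this
  linarith

theorem TotallyPositive.exists_le_geometric {φ : ℤ → ℝ} (h : TotallyPositive φ) (hs : Summable φ) :
    ∃ r C : ℝ, 0 < r ∧ r < 1 ∧ ∀ᶠ n : ℕ in atTop, φ n ≤ C * r ^ n := by
  by_cases h0 : ∀ n, φ n = 0
  · exact ⟨1 / 2, 0, by norm_num, by norm_num, Eventually.of_forall fun n => by simp [h0]⟩
  push Not at h0
  obtain ⟨p, hp⟩ := h0
  have hp : 0 < φ p := lt_of_le_of_ne (h.nonneg p) hp.symm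
  have hlim : Tendsto (fun n : ℕ => φ (p + n)) atTop (𝓝 0) :=
    (hs.comp_injective (i := fun n : ℕ => p + n) fun a b => by simp).tendsto_atTop_zero
  obtain ⟨d, hd, hd0⟩ := ((hlim.eventually_le_const (half_pos hp)).and
    (eventually_gt_atTop 0)).exists
  have hstep : ∀ x : ℤ, p ≤ x → φ (x + d) ≤ φ x / 2 := fun x hx => by
    rcases hx.eq_or_lt with rfl | hx
    · exact hd
    · have h1 := h.two_mul_le (p := p) (q := p + d) (x := x) (y := x + d) (by omega) hx (by omega)
      have h2 := mul_le_mul_of_nonneg_right hd (h.nonneg x)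
      have h3 : φ p * φ (x + d) ≤ φ p * (φ x / 2) := by linarith
      exact le_of_mul_le_mul_left h3 hp
  set r : ℝ := (1 / 2 : ℝ) ^ ((d : ℝ)⁻¹) with hr
  have hr0 : 0 < r := by positivity
  have hr1 : r < 1 := Real.rpow_lt_one (by norm_num) (by norm_num) (by positivity)
  have hrd : r ^ d = 1 / 2 := Real.rpow_inv_natCast_pow (by norm_num) hd0.ne'
  have hM : ∀ n, φ n ≤ ∑' m, φ m := fun n => hs.le_tsum n fun _ _ => h.nonneg _
  set P := p.toNat with hP
  have key : ∀ n : ℕ, φ (P + n) ≤ 2 * (∑' m, φ m) * r ^ n := by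
    intro n
    induction n using Nat.strong_induction_on with
    | _ n ih =>
      rcases lt_or_ge n d with hn | hn
      · have h1 : 1 / 2 ≤ r ^ n := hrd ▸ pow_le_pow_of_le_one hr0.le hr1.le hn.le
        have h2 : 0 ≤ ∑' m, φ m := tsum_nonneg h.nonneg
        have h3 := hM (P + n)
        nlinarith
      · obtain ⟨m, rfl⟩ := Nat.exists_eq_add_of_le' hn
        have h1 := ih m (by omega)
        have h2 := hstep (P + m) (by omega)
        have e : ((P : ℤ) + ((m + d : ℕ) : ℤ)) = P + m + d := by push_cast; ring
        rw [e, pow_add, hrd]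
        linarith
  refine ⟨r, 2 * (∑' m, φ m) * (r ^ P)⁻¹, hr0, hr1, ?_⟩
  filter_upwards [eventually_ge_atTop P] with n hn
  obtain ⟨m, rfl⟩ := Nat.exists_eq_add_of_le hn
  have h1 := key m
  push_cast
  rw [pow_add]
  field_simp
  linarith

theorem TotallyPositive.summable_nat_pow_mul {φ : ℤ → ℝ} (h : TotallyPositive φ) (hs : Summable φ)
    (k : ℕ) : Summable fun n : ℕ => (n : ℝ) ^ k * φ n := by
  obtain ⟨r, C, hr0, hr1, hC⟩ := h.exists_le_geometric hs
  refine Summable.of_norm_bounded_eventually_nat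
    (g := fun n => C * ((n : ℝ) ^ k * r ^ n)) ((summable_pow_mul_geometric_of_norm_lt_one k
      (by rwa [Real.norm_of_nonneg hr0.le])).mul_left C) ?_
  filter_upwards [hC] with n hn
  rw [Real.norm_of_nonneg (mul_nonneg (by positivity) (h.nonneg _))]
  have := mul_le_mul_of_nonneg_left hn (pow_nonneg (Nat.cast_nonneg (α := ℝ) n) k)
  linarith

theorem TotallyPositive.summable_abs_pow_mul {φ : ℤ → ℝ} (h : TotallyPositive φ) (hs : Summable φ)
    (k : ℕ) : Summable fun n : ℤ => |(n : ℝ)| ^ k * φ n := by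
  refine Summable.of_nat_of_neg ?_ ?_
  · simpa using h.summable_nat_pow_mul hs k
  · simpa using h.neg.summable_nat_pow_mul ((Equiv.neg ℤ).summable_iff.2 hs) k

section Determinants

open Polynomial Matrix

theorem det_vecCons_inv_eval {K : Type*} [Field K] {n : ℕ} (v : Fin (n + 1) → K) (t : K)
    (hv : ∀ i, v i - t ≠ 0) (p : ℕ → K[X]) (hp : ∀ k, (p k).Monic) (hd : ∀ k, (p k).natDegree = k) :
    (of fun i => vecCons (v i - t)⁻¹ fun k : Fin n => (p k).eval (v i)).det =
      (vandermonde v).det * ∏ i, (v i - t)⁻¹ := by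
  let q : Fin (n + 1) → K[X] := vecCons 1 fun k : Fin n => (X - C t) * p k
  have hq := det_eval_matrixOfPolynomials_eq_det_vandermonde v q
    (fun i => by
      refine Fin.cases ?_ (fun k => ?_) i
      · simp [q]
      · simp only [q, cons_val_succ, Fin.val_succ]
        rw [(monic_X_sub_C t).natDegree_mul (hp k), natDegree_X_sub_C, hd, add_comm])
    (fun i => by
      refine Fin.cases ?_ (fun k => ?_) i
      · simp [q]
      · simp only [q, cons_val_succ]
        exact (monic_X_sub_C t).mul (hp k))
  rw [hq, mul_comm, ← det_mul_column]
  congr 1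
  ext i j
  refine Fin.cases ?_ (fun k => ?_) j
  · simp [q]
  · simp only [q, of_apply, cons_val_succ, eval_mul, eval_sub, eval_X, eval_C]
    rw [inv_mul_cancel_left₀ (hv i)]

theorem det_vecCons_inv_inv_eval {K : Type*} [Field K] {n : ℕ} (v : Fin (n + 2) → K) (s t : K)
    (hs : ∀ i, v i - s ≠ 0) (ht : ∀ i, v i - t ≠ 0) (p : ℕ → K[X]) (hp : ∀ k, (p k).Monic)
    (hd : ∀ k, (p k).natDegree = k) :
    (of fun i => vecCons (v i - s)⁻¹ (vecCons (v i - t)⁻¹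
        fun k : Fin n => (p k).eval (v i))).det =
      (s - t) * (vandermonde v).det * ((∏ i, (v i - s)⁻¹) * ∏ i, (v i - t)⁻¹) := by
  let q : ℕ → K[X] := fun k => k.casesOn 1 fun k => (X - C t) * p k
  have hq : (vandermonde v).det * ∏ i, (v i - s)⁻¹ =
      (of fun i => vecCons (v i - s)⁻¹ fun k : Fin (n + 1) => (q k).eval (v i)).det :=
    (det_vecCons_inv_eval v s hs q
      (fun k => by
        cases k with
        | zero => simp [q]
        | succ k => exact (monic_X_sub_C t).mul (hp k))
      (fun k => by
        cases k with
        | zero => simp [q]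
        | succ k =>
          simp only [q]
          rw [(monic_X_sub_C t).natDegree_mul (hp k), natDegree_X_sub_C, hd, add_comm])).symm
  rw [mul_assoc, ← mul_assoc (vandermonde v).det, hq, mul_comm _ (∏ i, (v i - t)⁻¹),
    ← det_mul_column]
  set M : Matrix (Fin (n + 2)) (Fin (n + 2)) K := of fun i => vecCons (v i - s)⁻¹
    (vecCons (v i - t)⁻¹ fun k : Fin n => (p k).eval (v i)) with hM
  set Q : Matrix (Fin (n + 2)) (Fin (n + 2)) K := of fun i j => (v i - t)⁻¹ *
    of (fun i => vecCons (v i - s)⁻¹ fun k : Fin (n + 1) => (q k).eval (v i)) i j with hQ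
  rw [← det_updateCol_add_smul_self M (i := 0) (j := 1) (by simp) (-1)]
  conv_rhs => rw [← updateCol_eq_self Q 0]
  rw [← det_updateCol_smul]
  congr 1
  ext i j
  refine Fin.cases ?_ (fun j => Fin.cases ?_ (fun j => ?_) j) j
  · have h1 := hs i
    have h2 := ht i
    simp [hM, hQ]
    field_simp
    ring
  · simp [hM, hQ, q]
  · simp [hM, hQ, q]
    rw [inv_mul_cancel_left₀ (ht i)]

theorem HasSum.mul_det_updateCol {ι n : Type*} [Fintype n] [DecidableEq n] (M : Matrix n n ℂ)
    (j : n) {w : ι → ℂ} {g : ι → n → ℂ} {G : n → ℂ} (h : ∀ i, HasSum (fun m => w m * g m i) (G i)) :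
    HasSum (fun m => w m * (M.updateCol j (g m)).det) (M.updateCol j G).det := by
  have h1 : HasSum (fun m => w m • g m) G := Pi.hasSum.2 h
  have h2 := (LinearMap.toContinuousLinearMap
    ((LinearMap.proj j : (n → ℂ) →ₗ[ℂ] ℂ) ∘ₗ (Matrix.cramer M))).hasSum h1
  simpa [Function.comp_def, Matrix.cramer_apply] using h2

theorem HasSum.mul_det_vecCons {ι : Type*} {n : ℕ} {w : ι → ℂ} {g : ι → Fin (n + 1) → ℂ}
    {G : Fin (n + 1) → ℂ} (r : Fin (n + 1) → Fin n → ℂ)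
    (h : ∀ i, HasSum (fun m => w m * g m i) (G i)) :
    HasSum (fun m => w m * (of fun i => vecCons (g m i) (r i)).det)
      (of fun i => vecCons (G i) (r i)).det := by
  have e : ∀ a : Fin (n + 1) → ℂ, (of fun i => vecCons (a i) (r i)) =
      (of fun i => vecCons (0 : ℂ) (r i)).updateCol 0 a := fun a => by
    ext i j
    refine Fin.cases ?_ (fun j => ?_) j <;> simp
  have := HasSum.mul_det_updateCol (of fun i => vecCons (0 : ℂ) (r i)) 0 h
  simpa only [← e] using this

theorem HasSum.mul_det_vecCons_vecCons {ι : Type*} {n : ℕ} {w : ι → ℂ} {g : ι → Fin (n + 2) → ℂ}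
    {G : Fin (n + 2) → ℂ} (a : Fin (n + 2) → ℂ) (r : Fin (n + 2) → Fin n → ℂ)
    (h : ∀ i, HasSum (fun m => w m * g m i) (G i)) :
    HasSum (fun m => w m * (of fun i => vecCons (a i) (vecCons (g m i) (r i))).det)
      (of fun i => vecCons (a i) (vecCons (G i) (r i))).det := by
  have e : ∀ b : Fin (n + 2) → ℂ, (of fun i => vecCons (a i) (vecCons (b i) (r i))) =
      (of fun i => vecCons (a i) (vecCons 0 (r i))).updateCol 1 b := fun b => by
    ext i j
    refine Fin.cases ?_ (fun j => Fin.cases ?_ (fun j => ?_) j) j <;>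
      simp [Fin.succ_succ_ne_one]
  have := HasSum.mul_det_updateCol (of fun i => vecCons (a i) (vecCons 0 (r i))) 1 h
  simpa only [← e] using this

end Determinants

open Polynomial in
/-- The polynomials `x ↦ E (ξ + x) ^ k` of a distribution with finite moments. -/
theorem exists_monic_hasSum_moment {φ : ℤ → ℝ}
    (hs : ∀ k : ℕ, Summable fun n : ℤ => |(n : ℝ)| ^ k * φ n)
    (h1 : HasSum φ 1) : ∃ P : ℕ → ℂ[X], (∀ k, (P k).Monic) ∧ (∀ k, (P k).natDegree = k) ∧
      ∀ (k : ℕ) (x : ℂ), HasSum (fun m : ℤ => (φ m : ℂ) * ((m : ℂ) + x) ^ k) ((P k).eval x) := by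
  have hμ : ∀ k : ℕ, Summable fun m : ℤ => (φ m : ℂ) * (m : ℂ) ^ k := fun k => by
    refine summable_norm_iff.1 ((hs k).norm.congr fun m => ?_)
    simp [mul_comm]
  let μ : ℕ → ℂ := fun k => ∑' m : ℤ, (φ m : ℂ) * (m : ℂ) ^ k
  let R : ℕ → ℂ[X] := fun k => ∑ r : Fin k, C (μ (k - r) * (k.choose r : ℂ)) * X ^ (r : ℕ)
  have hR : ∀ k, (R k).degree < k := fun k => degree_sum_fin_lt _
  refine ⟨fun k => X ^ k + R k, fun k => monic_X_pow_add (hR k), fun k => ?_, fun k x => ?_⟩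
  · refine natDegree_eq_of_degree_eq_some ?_
    rw [degree_add_eq_left_of_degree_lt (by simpa using hR k), degree_X_pow]
  · have h2 := hasSum_sum (s := Finset.range (k + 1)) (f := fun r (m : ℤ) =>
      (φ m : ℂ) * (m : ℂ) ^ (k - r) * ((k.choose r : ℂ) * x ^ r)) fun r _ =>
      ((hμ (k - r)).hasSum.mul_right ((k.choose r : ℂ) * x ^ r))
    have h3 : ∀ m : ℤ, (φ m : ℂ) * ((m : ℂ) + x) ^ k = ∑ r ∈ Finset.range (k + 1),
        (φ m : ℂ) * (m : ℂ) ^ (k - r) * ((k.choose r : ℂ) * x ^ r) := fun m => by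
      rw [add_comm (m : ℂ), add_pow, Finset.mul_sum]
      exact Finset.sum_congr rfl fun r _ => by ring
    simp only [← h3] at h2
    have h4 : eval x (X ^ k + R k) = ∑ r ∈ Finset.range (k + 1),
        (∑' m : ℤ, (φ m : ℂ) * (m : ℂ) ^ (k - r)) * ((k.choose r : ℂ) * x ^ r) := by
      have h5 : ∑' m : ℤ, (φ m : ℂ) = 1 := by
        simpa using (Complex.hasSum_ofReal.2 h1).tsum_eq
      rw [Finset.sum_range_succ, Finset.sum_range]
      simp [R, μ, eval_finsetSum, h5, mul_assoc, add_comm]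
    rw [h4]
    exact h2

/-- The weight of a configuration of `N` labelled particles obtained from the densely packed
configuration `0, …, N - 1` by the Markov kernel with Toeplitz matrix `φ`. -/
noncomputable def toeplitzWeight (φ : ℤ → ℝ) (N : ℕ) (l : Fin N → ℤ) : ℝ :=
  (Matrix.of fun i j : Fin N => φ (l i - (j : ℕ))).det *
    (Matrix.vandermonde fun i => (l i : ℝ)).det /
      (N.factorial * (Matrix.vandermonde fun i : Fin N => ((i : ℕ) : ℝ)).det)

theorem det_vandermonde_pos {N : ℕ} {v : Fin N → ℝ} (hv : StrictMono v) :
    0 < (Matrix.vandermonde v).det := by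
  rw [Matrix.det_vandermonde]
  exact Finset.prod_pos fun i _ => Finset.prod_pos fun j hj =>
    sub_pos.2 (hv (Finset.mem_Ioi.1 hj))

theorem det_vandermonde_fin_pos (N : ℕ) :
    0 < (Matrix.vandermonde fun i : Fin N => ((i : ℕ) : ℝ)).det :=
  det_vandermonde_pos fun i j h => by simpa using h

theorem toeplitzWeight_nonneg {φ : ℤ → ℝ} (hφ : TotallyPositive φ) (N : ℕ) (l : Fin N → ℤ) :
    0 ≤ toeplitzWeight φ N l := by
  refine div_nonneg ?_ (mul_nonneg (Nat.cast_nonneg _) (det_vandermonde_fin_pos N).le)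
  refine det_mul_det_nonneg_of_strictMono (P := fun x j => φ (x - (j : ℕ)))
    (Q := fun x j => (x : ℝ) ^ (j : ℕ)) (fun l hl => ?_) (fun l hl => ?_) l
  · rw [← Matrix.det_transpose]
    exact hφ.det_nonneg (i := fun j : Fin N => ((j : ℕ) : ℤ)) (fun i j h => by simpa using h) hl
  · exact (det_vandermonde_pos (v := fun i => (l i : ℝ)) fun i j h =>
      Int.cast_lt.2 (hl h)).le

theorem injective_of_toeplitzWeight_ne_zero {φ : ℤ → ℝ} {N : ℕ} {l : Fin N → ℤ}
    (h : toeplitzWeight φ N l ≠ 0) : Function.Injective l := by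
  have h2 : (Matrix.vandermonde fun i => (l i : ℝ)).det ≠ 0 := fun h0 => h (by
    simp [toeplitzWeight, h0])
  rw [Matrix.det_vandermonde_ne_zero_iff] at h2
  exact fun i j hij => h2 (by simp [hij])

theorem toeplitzWeight_ofReal (φ : ℤ → ℝ) (N : ℕ) (l : Fin N → ℤ) :
    (toeplitzWeight φ N l : ℂ) =
      (Matrix.of fun i j : Fin N => (φ (l i - (j : ℕ)) : ℂ)).det *
    (Matrix.vandermonde fun i => (l i : ℂ)).det /
      (N.factorial * (Matrix.vandermonde fun i : Fin N => ((i : ℕ) : ℂ)).det) := by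
  have h1 : ∀ A : Matrix (Fin N) (Fin N) ℝ, ((A.det : ℝ) : ℂ) = (A.map Complex.ofReal).det :=
    fun A => Complex.ofRealHom.map_det A
  unfold toeplitzWeight
  push_cast [h1]
  congr 1
  · congr 2
    ext; simp [Matrix.vandermonde]
  · congr 2
    ext; simp [Matrix.vandermonde]

/-- Averages of determinants against the Toeplitz weights. -/
theorem hasSum_toeplitz_det {φ : ℤ → ℝ} {N : ℕ} (f : Fin N → ℤ → ℂ) (M : Fin N → Fin N → ℂ)
    (hM : ∀ j k : Fin N, HasSum (fun m : ℤ => (φ m : ℂ) * f k (m + (j : ℕ))) (M j k)) :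
    HasSum (fun l : Fin N → ℤ => (Matrix.of fun i j : Fin N => (φ (l i - (j : ℕ)) : ℂ)).det *
      (Matrix.of fun i k => f k (l i)).det) (N.factorial * (Matrix.of M).det) := by
  have h1 : ∀ j k : Fin N, HasSum (fun x : ℤ => (φ (x - (j : ℕ)) : ℂ) * f k x) (M j k) :=
      fun j k => by
    have := (Equiv.subRight ((j : ℕ) : ℤ)).hasSum_iff.2 (hM j k)
    simpa [Function.comp_def] using this
  have h2 := hasSum_det_mul_det (fun (j : Fin N) (x : ℤ) => (φ (x - (j : ℕ)) : ℂ))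
    (fun x k => f k x) fun j k => summable_norm_iff.2 (h1 j k).summable
  have h3 : (fun j k : Fin N => ∑' x : ℤ, (φ (x - (j : ℕ)) : ℂ) * f k x) = M :=
    funext fun j => funext fun k => (h1 j k).tsum_eq
  rwa [h3] at h2

/-- The ratio of the characteristic polynomials, at `t`, of the configurations `0, …, N - 1`
and `l`. -/
noncomputable def charRatio {N : ℕ} (l : Fin N → ℤ) (t : ℂ) : ℂ :=
  ∏ i : Fin N, (((i : ℕ) : ℂ) - t) / ((l i : ℂ) - t)

theorem intCast_sub_ne_zero {t : ℂ} (ht : t.im ≠ 0) (m : ℤ) : (m : ℂ) - t ≠ 0 := fun h =>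
  ht (by simpa using congrArg Complex.im h)

theorem natCast_sub_ne_zero {t : ℂ} (ht : t.im ≠ 0) (m : ℕ) : (m : ℂ) - t ≠ 0 := fun h =>
  ht (by simpa using congrArg Complex.im h)

theorem toeplitzWeight_mul_prod_inv (φ : ℤ → ℝ) {N : ℕ} (l : Fin N → ℤ) :
    (toeplitzWeight φ N l : ℂ) =
      (N.factorial * (Matrix.vandermonde fun i : Fin N => ((i : ℕ) : ℂ)).det)⁻¹ *
      ((Matrix.of fun i j : Fin N => (φ (l i - (j : ℕ)) : ℂ)).det *
        (Matrix.vandermonde fun i => (l i : ℂ)).det) := by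
  rw [toeplitzWeight_ofReal, div_eq_inv_mul]

theorem vandermonde_fin_ne_zero (N : ℕ) :
    (Matrix.vandermonde fun i : Fin N => ((i : ℕ) : ℂ)).det ≠ 0 := by
  rw [Matrix.det_vandermonde_ne_zero_iff]
  exact fun i j h => Fin.ext (Nat.cast_injective h)

section

variable {φ : ℤ → ℝ}

theorem hasSum_toeplitzWeight (hs : ∀ k : ℕ, Summable fun n : ℤ => |(n : ℝ)| ^ k * φ n)
    (h1 : HasSum φ 1) (N : ℕ) : HasSum (toeplitzWeight φ N) 1 := by
  obtain ⟨P, hP, hd, hsum⟩ := exists_monic_hasSum_moment hs h1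
  have h := hasSum_toeplitz_det (φ := φ) (N := N) (fun k x => (x : ℂ) ^ (k : ℕ))
    (fun j k => (P k).eval ((j : ℕ) : ℂ)) fun j k => by simpa using hsum k j
  rw [← Matrix.det_eval_matrixOfPolynomials_eq_det_vandermonde (fun j : Fin N => ((j : ℕ) : ℂ))
    (fun k => P k) (fun k => hd k) (fun k => hP k)] at h
  have h2 := h.mul_left (N.factorial *
    (Matrix.vandermonde fun i : Fin N => ((i : ℕ) : ℂ)).det)⁻¹
  rw [inv_mul_cancel₀ (mul_ne_zero (by exact_mod_cast N.factorial_ne_zero)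
    (vandermonde_fin_ne_zero N))] at h2
  rw [← Complex.hasSum_ofReal]
  refine (h2.congr_fun fun l => ?_)
  exact toeplitzWeight_mul_prod_inv φ l

theorem hasSum_mul_inv_sub (h1 : HasSum φ 1) (h0 : ∀ n, 0 ≤ φ n) {t : ℂ} (ht : t.im ≠ 0) (j : ℕ) :
    HasSum (fun m : ℤ => (φ m : ℂ) * (j - (t - m))⁻¹) (∑' m : ℤ, (φ m : ℂ) * (j - (t - m))⁻¹) := by
  refine Summable.hasSum (Summable.of_norm_bounded (h1.summable.mul_right |t.im|⁻¹) fun m => ?_)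
  rw [norm_mul, Complex.norm_real, Real.norm_of_nonneg (h0 m), norm_inv]
  refine mul_le_mul_of_nonneg_left (inv_anti₀ (abs_pos.2 ht) ?_) (h0 m)
  simpa using Complex.abs_im_le_norm (j - (t - m))

theorem charRatio_eq {N : ℕ} (l : Fin N → ℤ) (t : ℂ) :
    charRatio l t = (∏ i : Fin N, (((i : ℕ) : ℂ) - t)) * ∏ i, ((l i : ℂ) - t)⁻¹ := by
  simp only [charRatio, div_eq_mul_inv, Finset.prod_mul_distrib]

theorem charRatio_add_eq (N : ℕ) (m : ℤ) (t : ℂ) :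
    charRatio (fun j : Fin N => m + (j : ℕ)) t =
      (∏ i : Fin N, (((i : ℕ) : ℂ) - t)) * ∏ j : Fin N, (((j : ℕ) : ℂ) - (t - m))⁻¹ := by
  rw [charRatio_eq]
  congr 1
  refine Finset.prod_congr rfl fun j _ => ?_
  push_cast
  ring_nf

theorem hasSum_toeplitzWeight_mul_charRatio
    (hs : ∀ k : ℕ, Summable fun n : ℤ => |(n : ℝ)| ^ k * φ n)
    (h1 : HasSum φ 1) (h0 : ∀ n, 0 ≤ φ n) (N : ℕ) {t : ℂ} (ht : t.im ≠ 0) :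
    ∃ A, HasSum (fun m : ℤ => (φ m : ℂ) * charRatio (fun j : Fin (N + 1) => m + (j : ℕ)) t) A ∧
      HasSum (fun l => (toeplitzWeight φ (N + 1) l : ℂ) * charRatio l t) A := by
  obtain ⟨P, hP, hd, hsum⟩ := exists_monic_hasSum_moment hs h1
  set W := (Matrix.vandermonde fun i : Fin (N + 1) => ((i : ℕ) : ℂ)).det with hW
  have hW0 : W ≠ 0 := vandermonde_fin_ne_zero _
  have hF0 : ((N + 1).factorial : ℂ) ≠ 0 := by exact_mod_cast Nat.factorial_ne_zero _
  set p := ∏ i : Fin (N + 1), (((i : ℕ) : ℂ) - t) with hp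
  have hG := fun j : Fin (N + 1) => hasSum_mul_inv_sub h1 h0 ht j
  set G := fun j : Fin (N + 1) => ∑' m : ℤ, (φ m : ℂ) * (((j : ℕ) : ℂ) - (t - m))⁻¹ with hGdef
  have h := hasSum_toeplitz_det (φ := φ) (N := N + 1)
    (fun k x => Matrix.vecCons ((x : ℂ) - t)⁻¹ (fun k : Fin N => (x : ℂ) ^ (k : ℕ)) k)
    (fun j => Matrix.vecCons (G j) fun k => (P k).eval ((j : ℕ) : ℂ)) fun j k => by
      refine Fin.cases ?_ (fun k => ?_) k
      · refine (hG j).congr_fun fun m => ?_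
        rw [Matrix.cons_val_zero]
        congr 2
        push_cast
        ring
      · simpa using hsum k j
  have hM := HasSum.mul_det_vecCons (G := G)
    (fun (j : Fin (N + 1)) (k : Fin N) => (P k).eval ((j : ℕ) : ℂ)) hG
  set Δ := (Matrix.of fun j : Fin (N + 1) =>
    Matrix.vecCons (G j) fun k : Fin N => (P k).eval ((j : ℕ) : ℂ)).det
  have hM2 := hM.mul_left (W⁻¹ * p)
  have h2 := h.mul_left ((((N + 1).factorial : ℂ) * W)⁻¹ * p)
  refine ⟨_, hM2.congr_fun fun m => ?_, ?_⟩
  · rw [det_vecCons_inv_eval _ _ (fun j => ?_) P hP hd, charRatio_add_eq, ← hW, ← hp]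
    · field_simp
    · exact natCast_sub_ne_zero (by simpa using ht) _
  · have hv : W⁻¹ * p * Δ =
        (((N + 1).factorial : ℂ) * W)⁻¹ * p * (((N + 1).factorial : ℂ) * Δ) := by
      field_simp
    rw [hv]
    refine h2.congr_fun fun l => ?_
    have := det_vecCons_inv_eval (fun i => (l i : ℂ)) t (fun i => intCast_sub_ne_zero ht _)
      (fun k => Polynomial.X ^ k) (fun k => Polynomial.monic_X_pow k)
      (fun k => Polynomial.natDegree_X_pow k)
    simp only [Polynomial.eval_pow, Polynomial.eval_X] at this
    rw [toeplitzWeight_mul_prod_inv, charRatio_eq, ← hW, ← hp]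
    refine Eq.trans ?_ (congrArg (fun z => ((((N + 1).factorial : ℂ) * W)⁻¹ * p *
      ((Matrix.of fun i j : Fin (N + 1) => (φ (l i - (j : ℕ)) : ℂ)).det * z))) this.symm)
    ring

theorem hasSum_toeplitzWeight_mul_charRatio_mul_charRatio
    (hm : ∀ k : ℕ, Summable fun n : ℤ => |(n : ℝ)| ^ k * φ n)
    (h1 : HasSum φ 1) (h0 : ∀ n, 0 ≤ φ n) (N : ℕ) {s t : ℂ} (hs : s.im ≠ 0) (ht : t.im ≠ 0)
    (hst : s ≠ t) :
    ∃ (I : ℤ → ℂ) (E : ℂ), (∀ m, HasSum (fun n : ℤ => (φ m : ℂ) * (φ n * ((s - m - (t - n)) *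
        (charRatio (fun j : Fin (N + 2) => m + (j : ℕ)) s *
        charRatio (fun j : Fin (N + 2) => n + (j : ℕ)) t)))) (I m)) ∧ HasSum I ((s - t) * E) ∧
      HasSum (fun l => (toeplitzWeight φ (N + 2) l : ℂ) * (charRatio l s * charRatio l t)) E := by
  obtain ⟨P, hP, hd, hsum⟩ := exists_monic_hasSum_moment hm h1
  set W := (Matrix.vandermonde fun i : Fin (N + 2) => ((i : ℕ) : ℂ)).det with hW
  have hW0 : W ≠ 0 := vandermonde_fin_ne_zero _
  have hst0 : s - t ≠ 0 := sub_ne_zero.2 hst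
  have hF0 : ((N + 2).factorial : ℂ) ≠ 0 := by exact_mod_cast Nat.factorial_ne_zero _
  set p := ∏ i : Fin (N + 2), (((i : ℕ) : ℂ) - s) with hp
  set q := ∏ i : Fin (N + 2), (((i : ℕ) : ℂ) - t) with hq
  have hG := fun j : Fin (N + 2) => hasSum_mul_inv_sub h1 h0 hs j
  set G := fun j : Fin (N + 2) => ∑' m : ℤ, (φ m : ℂ) * (((j : ℕ) : ℂ) - (s - m))⁻¹ with hGdef
  have hH := fun j : Fin (N + 2) => hasSum_mul_inv_sub h1 h0 ht j
  set H := fun j : Fin (N + 2) => ∑' m : ℤ, (φ m : ℂ) * (((j : ℕ) : ℂ) - (t - m))⁻¹ with hHdef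
  let r : Fin (N + 2) → Fin N → ℂ := fun j k => (P k).eval ((j : ℕ) : ℂ)
  have h := hasSum_toeplitz_det (φ := φ) (N := N + 2)
    (fun k x => Matrix.vecCons ((x : ℂ) - s)⁻¹ (Matrix.vecCons ((x : ℂ) - t)⁻¹
      (fun k : Fin N => (x : ℂ) ^ (k : ℕ))) k)
    (fun j => Matrix.vecCons (G j) (Matrix.vecCons (H j) (r j))) fun j k => by
      refine Fin.cases ?_ (fun k => Fin.cases ?_ (fun k => ?_) k) k
      · refine (hG j).congr_fun fun m => ?_
        rw [Matrix.cons_val_zero]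
        congr 2
        push_cast
        ring
      · refine (hH j).congr_fun fun m => ?_
        rw [Matrix.cons_val_succ, Matrix.cons_val_zero]
        congr 2
        push_cast
        ring
      · simpa using hsum k j
  have hM := HasSum.mul_det_vecCons (G := G) (fun j => Matrix.vecCons (H j) (r j)) hG
  have hM1 := fun m : ℤ => HasSum.mul_det_vecCons_vecCons (G := H)
    (fun j => (((j : ℕ) : ℂ) - (s - m))⁻¹) r hH
  set Δ := (Matrix.of fun j : Fin (N + 2) =>
    Matrix.vecCons (G j) (Matrix.vecCons (H j) (r j))).det
  have h2 := h.mul_left ((((N + 2).factorial : ℂ) * W)⁻¹ * (p * q) * (s - t)⁻¹)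
  refine ⟨fun m => W⁻¹ * (p * q) * (φ m * (Matrix.of fun j : Fin (N + 2) => Matrix.vecCons
    (((j : ℕ) : ℂ) - (s - m))⁻¹ (Matrix.vecCons (H j) (r j))).det),
    (s - t)⁻¹ * (W⁻¹ * (p * q) * Δ), fun m => ?_, ?_, ?_⟩
  rotate_left
  · rw [mul_inv_cancel_left₀ hst0]
    exact hM.mul_left (W⁻¹ * (p * q))
  · have hv : (s - t)⁻¹ * (W⁻¹ * (p * q) * Δ) = (((N + 2).factorial : ℂ) * W)⁻¹ * (p * q) *
        (s - t)⁻¹ * (((N + 2).factorial : ℂ) * Δ) := by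
      field_simp
    rw [hv]
    refine h2.congr_fun fun l => ?_
    have := det_vecCons_inv_inv_eval (fun i => (l i : ℂ)) s t (fun i => intCast_sub_ne_zero hs _)
      (fun i => intCast_sub_ne_zero ht _)
      (fun k => Polynomial.X ^ k) (fun k => Polynomial.monic_X_pow k)
      (fun k => Polynomial.natDegree_X_pow k)
    simp only [Polynomial.eval_pow, Polynomial.eval_X] at this
    rw [toeplitzWeight_mul_prod_inv, charRatio_eq, charRatio_eq, ← hW, ← hp, ← hq]
    refine Eq.trans ?_ (congrArg (fun z => ((((N + 2).factorial : ℂ) * W)⁻¹ * (p * q) *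
      (s - t)⁻¹ * ((Matrix.of fun i j : Fin (N + 2) => (φ (l i - (j : ℕ)) : ℂ)).det * z)))
        this.symm)
    field_simp
  · refine (((hM1 m).mul_left (φ m : ℂ)).mul_left (W⁻¹ * (p * q))).congr_fun fun n => ?_
    rw [det_vecCons_inv_inv_eval _ _ _ (fun j => ?_) (fun j => ?_) P hP hd, charRatio_add_eq,
      charRatio_add_eq, ← hW, ← hp, ← hq]
    · field_simp
    · exact natCast_sub_ne_zero (by simpa using hs) _
    · exact natCast_sub_ne_zero (by simpa using ht) _

end

/-- The spectral parameter, for a system of `N` particles, attached to a point of the circle. -/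
noncomputable def circleParam (N : ℕ) (u : ℂ) : ℂ := N * (u / (u - 1)) - 1 / 2

theorem div_sub_one_re {u : ℂ} (hu : ‖u‖ = 1) (hu1 : u ≠ 1) : (u / (u - 1)).re = 1 / 2 := by
  have h1 : Complex.normSq (u - 1) ≠ 0 := by simpa [sub_eq_zero] using hu1
  have h2 : Complex.normSq u = 1 := by rw [Complex.normSq_eq_norm_sq, hu, one_pow]
  rw [Complex.div_re]
  rw [Complex.normSq_apply] at h1 h2
  simp at h1 h2 ⊢
  simp only [Complex.normSq_apply, Complex.sub_re, Complex.sub_im, Complex.one_re, Complex.one_im,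
    sub_zero]
  have h3 : (u.re - 1) * (u.re - 1) + u.im * u.im ≠ 0 := h1
  rw [← add_div, div_eq_iff h3]
  linarith

theorem div_sub_one_im {u : ℂ} : (u / (u - 1)).im = -u.im / Complex.normSq (u - 1) := by
  rw [Complex.div_im]
  simp
  ring

theorem ne_one_of_im_ne_zero {u : ℂ} (hu : u.im ≠ 0) : u ≠ 1 := fun h => hu (by simp [h])

theorem div_sub_one_im_ne_zero {u : ℂ} (hu : u.im ≠ 0) : (u / (u - 1)).im ≠ 0 := by
  rw [div_sub_one_im]
  refine div_ne_zero (neg_ne_zero.2 hu) ?_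
  simpa [sub_eq_zero] using ne_one_of_im_ne_zero hu

theorem circleParam_im (N : ℕ) (u : ℂ) : (circleParam N u).im = N * (u / (u - 1)).im := by
  simp [circleParam]

theorem circleParam_im_ne_zero {N : ℕ} (hN : N ≠ 0) {u : ℂ} (hu : u.im ≠ 0) :
    (circleParam N u).im ≠ 0 := by
  rw [circleParam_im]
  exact mul_ne_zero (by exact_mod_cast hN) (div_sub_one_im_ne_zero hu)

theorem circleParam_re (N : ℕ) {u : ℂ} (hu : ‖u‖ = 1) (hu1 : u ≠ 1) :
    (circleParam N u).re = (N - 1) / 2 := by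
  have := div_sub_one_re hu hu1
  simp only [circleParam, Complex.sub_re, Complex.mul_re, Complex.natCast_re, this,
    Complex.natCast_im]
  simp
  ring

theorem charRatio_conj {N : ℕ} (l : Fin N → ℤ) (t : ℂ) :
    charRatio l (starRingEnd ℂ t) = starRingEnd ℂ (charRatio l t) := by
  simp [charRatio, map_prod]

theorem charRatio_shift_zero (N : ℕ) {t : ℂ} (ht : t.im ≠ 0) :
    charRatio (fun j : Fin N => 0 + ((j : ℕ) : ℤ)) t = 1 := by
  refine Finset.prod_eq_one fun j _ => ?_
  simp [div_self (natCast_sub_ne_zero ht j)]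

theorem charRatio_shift_succ (N : ℕ) {t : ℂ} (ht : t.im ≠ 0) (m : ℤ) :
    charRatio (fun j : Fin N => m + 1 + ((j : ℕ) : ℤ)) t =
      charRatio (fun j : Fin N => m + ((j : ℕ) : ℤ)) t * ((m - t) / (m + N - t)) := by
  have h := fun k : ℤ => intCast_sub_ne_zero ht k
  have h0 : ∏ j ∈ Finset.range (N + 1), ((m : ℂ) + (j : ℕ) - t) ≠ 0 :=
    Finset.prod_ne_zero_iff.2 fun j _ => by simpa using h (m + j)
  have h1 := Finset.prod_range_succ (fun j : ℕ => (m : ℂ) + j - t) N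
  have h2 := Finset.prod_range_succ' (fun j : ℕ => (m : ℂ) + j - t) N
  simp only [charRatio_eq, mul_assoc, Finset.prod_inv_distrib]
  congr 1
  rw [Fin.prod_univ_eq_prod_range (fun j : ℕ => (((m + 1 + (j : ℤ) : ℤ) : ℂ) - t)) N,
    Fin.prod_univ_eq_prod_range (fun j : ℕ => (((m + (j : ℤ) : ℤ) : ℂ) - t)) N]
  have e1 : ∏ j ∈ Finset.range N, (((m + 1 + (j : ℤ) : ℤ) : ℂ) - t) =
      ∏ j ∈ Finset.range N, ((m : ℂ) + ((j + 1 : ℕ) : ℂ) - t) :=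
    Finset.prod_congr rfl fun j _ => by push_cast; ring
  have e2 : ∏ j ∈ Finset.range N, (((m + (j : ℤ) : ℤ) : ℂ) - t) =
      ∏ j ∈ Finset.range N, ((m : ℂ) + (j : ℂ) - t) :=
    Finset.prod_congr rfl fun j _ => by push_cast; ring
  rw [e1, e2]
  have h3 := h1.symm.trans h2
  rw [h1] at h0
  have h4 := h0
  rw [h3] at h4
  rw [Nat.cast_zero, add_zero] at h3 h4
  have ha := left_ne_zero_of_mul h0
  have hb := right_ne_zero_of_mul h0
  have hc := left_ne_zero_of_mul h4
  field_simp
  linear_combination h3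

theorem norm_charRatio_shift_le_one (N : ℕ) {t : ℂ} (ht : t.im ≠ 0) (htr : t.re = (N - 1) / 2)
    (m : ℤ) : ‖charRatio (fun j : Fin N => m + ((j : ℕ) : ℤ)) t‖ ≤ 1 := by
  have hsq : ∀ m : ℤ, ‖(m : ℂ) + N - t‖ ^ 2 - ‖(m : ℂ) - t‖ ^ 2 = N * (2 * m + 1) := fun m => by
    simp only [← Complex.normSq_eq_norm_sq, Complex.normSq_apply]
    simp [htr]
    ring
  have hne : ∀ m : ℤ, (0 : ℝ) < ‖(m : ℂ) - t‖ := fun m =>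
    norm_pos_iff.2 (intCast_sub_ne_zero ht m)
  have hne2 : ∀ m : ℤ, (0 : ℝ) < ‖(m : ℂ) + N - t‖ := fun m => by
    simpa using hne (m + N)
  have hs := fun m => congrArg norm (charRatio_shift_succ N ht m)
  simp only [norm_mul, norm_div] at hs
  induction m using Int.induction_on with
  | zero => rw [charRatio_shift_zero N ht, norm_one]
  | succ m ih =>
    rw [hs]
    refine mul_le_one₀ ih (by positivity) ?_
    rw [div_le_one (hne2 _)]
    refine le_of_sq_le_sq ?_ (norm_nonneg _)
    have := hsq m
    have : (0 : ℝ) ≤ N * (2 * (m : ℤ) + 1) := by positivity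
    linarith
  | pred m ih =>
    have h := hs (-m - 1)
    rw [sub_add_cancel] at h
    rw [h] at ih
    refine le_trans ?_ ih
    refine le_mul_of_one_le_right (norm_nonneg _) ?_
    rw [one_le_div (hne2 _)]
    refine le_of_sq_le_sq ?_ (norm_nonneg _)
    have h2 := hsq (-m - 1)
    push_cast at h2 ⊢
    have : (0 : ℝ) ≤ N * (2 * m + 1) := by positivity
    linarith

theorem tendsto_charRatio_shift {u : ℂ} (hu : u.im ≠ 0) (m : ℤ) :
    Tendsto (fun N : ℕ => charRatio (fun j : Fin N => m + ((j : ℕ) : ℤ)) (circleParam N u)) atTop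
      (𝓝 (u ^ m)) := by
  have hu0 : u ≠ 0 := fun h => hu (by simp [h])
  have hu1 := sub_ne_zero.2 (ne_one_of_im_ne_zero hu)
  have hratio : ∀ m : ℤ, Tendsto (fun N : ℕ => ((m : ℂ) - circleParam N u) /
      (m + N - circleParam N u)) atTop (𝓝 u) := fun m => by
    have h1 : Tendsto (fun N : ℕ => ((m : ℂ) + 1 / 2) / (N : ℂ)) atTop (𝓝 0) :=
      tendsto_const_div_atTop_nhds_zero_nat _
    have h2 : Tendsto (fun N : ℕ => (((m : ℂ) + 1 / 2) / (N : ℂ) - u / (u - 1)) /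
        (((m : ℂ) + 1 / 2) / (N : ℂ) + 1 - u / (u - 1))) atTop
        (𝓝 ((0 - u / (u - 1)) / (0 + 1 - u / (u - 1)))) := by
      refine (h1.sub_const _).div ((h1.add_const _).sub_const _) ?_
      have : (0 : ℂ) + 1 - u / (u - 1) = -(u - 1)⁻¹ := by field_simp; ring
      rw [this]
      exact neg_ne_zero.2 (inv_ne_zero hu1)
    have h3 : (0 - u / (u - 1)) / (0 + 1 - u / (u - 1)) = u := by
      have : (0 : ℂ) + 1 - u / (u - 1) = -(u - 1)⁻¹ := by field_simp; ring
      rw [this]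
      field_simp
      ring
    rw [h3] at h2
    refine h2.congr' ?_
    filter_upwards [eventually_gt_atTop 0] with N hN
    have hN0 : (N : ℂ) ≠ 0 := by exact_mod_cast hN.ne'
    rw [← mul_div_mul_left _ _ hN0]
    congr 1 <;> · simp only [circleParam]; field_simp; ring
  have hs : ∀ m : ℤ, ∀ᶠ N : ℕ in atTop,
      charRatio (fun j : Fin N => m + 1 + ((j : ℕ) : ℤ)) (circleParam N u) =
      charRatio (fun j : Fin N => m + ((j : ℕ) : ℤ)) (circleParam N u) *
        (((m : ℂ) - circleParam N u) / (m + N - circleParam N u)) := fun m => by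
    filter_upwards [eventually_gt_atTop 0] with N hN
    exact charRatio_shift_succ N (circleParam_im_ne_zero hN.ne' hu) m
  induction m using Int.induction_on with
  | zero =>
    refine (tendsto_const_nhds (x := (1 : ℂ))).congr' ?_ |>.trans (by simp)
    filter_upwards [eventually_gt_atTop 0] with N hN
    exact (charRatio_shift_zero N (circleParam_im_ne_zero hN.ne' hu)).symm
  | succ m ih =>
    rw [zpow_add_one₀ hu0]
    exact (ih.mul (hratio m)).congr' ((hs m).mono fun N h => h.symm)
  | pred m ih =>
    rw [zpow_sub_one₀ hu0, ← div_eq_mul_inv]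
    refine (ih.div (hratio (-m - 1)) hu0).congr' ?_
    filter_upwards [hs (-m - 1), eventually_gt_atTop 0] with N h hN
    rw [sub_add_cancel] at h
    have ht := circleParam_im_ne_zero hN.ne' hu
    have h1 := intCast_sub_ne_zero ht (-m - 1)
    have h2 := intCast_sub_ne_zero ht (-m - 1 + N)
    simp only [Pi.div_apply]
    rw [h]
    push_cast at h1 h2 ⊢
    rw [mul_div_assoc, div_self (div_ne_zero h1 h2), mul_one]

section
variable {φ : ℤ → ℝ}

theorem norm_moment_sub_mul_le (hm : ∀ k : ℕ, Summable fun n : ℤ => |(n : ℝ)| ^ k * φ n)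
    (h1 : HasSum φ 1) (h0 : ∀ n, 0 ≤ φ n) (d : ℂ) {R S : ℤ → ℂ} (hR : ∀ m, ‖R m‖ ≤ 1)
    (hS : ∀ m, ‖S m‖ ≤ 1) {A B D : ℂ} (hA : HasSum (fun m => (φ m : ℂ) * R m) A)
    (hB : HasSum (fun m => (φ m : ℂ) * S m) B) {I : ℤ → ℂ}
    (hI : ∀ m : ℤ, HasSum (fun n : ℤ => (φ m : ℂ) * (φ n * ((d - m + n) * (R m * S n)))) (I m))
    (hD : HasSum I D) : ‖D - d * (A * B)‖ ≤ 2 * ∑' n : ℤ, |(n : ℝ)| * φ n := by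
  have hμ : HasSum (fun n : ℤ => |(n : ℝ)| * φ n) (∑' n : ℤ, |(n : ℝ)| * φ n) := by
    simpa using (hm 1).hasSum
  set μ := ∑' n : ℤ, |(n : ℝ)| * φ n
  have h2 : HasSum (fun m => I m - d * (φ m * R m * B)) (D - d * (A * B)) :=
    hD.sub ((hA.mul_right B).mul_left d)
  have h3 : HasSum (fun m : ℤ => |(m : ℝ)| * φ m + φ m * μ) (μ + 1 * μ) := hμ.add (h1.mul_right μ)
  have h4 := h2.norm_le_of_bounded h3 fun m => by
    have h5 := (hI m).sub ((hB.mul_left (φ m * R m : ℂ)).mul_left d)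
    have h6 : HasSum (fun n : ℤ => (φ m * |(m : ℝ)|) * φ n + φ m * (|(n : ℝ)| * φ n))
        ((φ m * |(m : ℝ)|) * 1 + φ m * μ) := (h1.mul_left _).add (hμ.mul_left _)
    refine (h5.norm_le_of_bounded h6 fun n => ?_).trans_eq (by ring)
    have e : (φ m : ℂ) * (φ n * ((d - m + n) * (R m * S n))) - d * (φ m * R m * (φ n * S n)) =
        (φ m * φ n : ℝ) * (((n : ℂ) - m) * (R m * S n)) := by push_cast; ring
    rw [e, norm_mul, Complex.norm_real, Real.norm_of_nonneg (mul_nonneg (h0 m) (h0 n)), norm_mul,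
      norm_mul]
    have h7 : ‖(n : ℂ) - m‖ ≤ |(n : ℝ)| + |(m : ℝ)| := by
      refine (norm_sub_le _ _).trans_eq ?_
      simp
    have h8 : ‖R m‖ * ‖S n‖ ≤ 1 := mul_le_one₀ (hR m) (norm_nonneg _) (hS n)
    calc φ m * φ n * (‖(n : ℂ) - m‖ * (‖R m‖ * ‖S n‖))
        ≤ φ m * φ n * ((|(n : ℝ)| + |(m : ℝ)|) * 1) := by
          refine mul_le_mul_of_nonneg_left ?_ (mul_nonneg (h0 m) (h0 n))
          exact mul_le_mul h7 h8 (by positivity) (by positivity)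
      _ = _ := by ring
  linarith

theorem exists_hasSum_toeplitzWeight_variance
    (hm : ∀ k : ℕ, Summable fun n : ℤ => |(n : ℝ)| ^ k * φ n)
    (h1 : HasSum φ 1) (h0 : ∀ n, 0 ≤ φ n) (N : ℕ) {u : ℂ} (hu : ‖u‖ = 1) (hu0 : u.im ≠ 0) :
    ∃ (A : ℂ) (V : ℝ),
      HasSum (fun m : ℤ => (φ m : ℂ) *
        charRatio (fun j : Fin (N + 2) => m + (j : ℕ)) (circleParam (N + 2) u)) A ∧
      HasSum (fun l => toeplitzWeight φ (N + 2) l *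
        ‖charRatio l (circleParam (N + 2) u) - A‖ ^ 2) V ∧
      V ≤ ((∑' n : ℤ, |(n : ℝ)| * φ n) / |(u / (u - 1)).im|) / (N + 2) := by
  have ht := circleParam_im_ne_zero (N := N + 2) (by omega) hu0
  have htr := circleParam_re (N + 2) hu (ne_one_of_im_ne_zero hu0)
  have hti := circleParam_im (N + 2) u
  set t := circleParam (N + 2) u
  set s := starRingEnd ℂ t with hsdef
  have hs : s.im ≠ 0 := by simpa [hsdef] using ht
  have hsr : s.re = ((N + 2 : ℕ) - 1) / 2 := by simpa [hsdef] using htr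
  have hd : ‖s - t‖ = 2 * ((N + 2) * |(u / (u - 1)).im|) := by
    have : s - t = ((-2 * t.im : ℝ) : ℂ) * Complex.I := by
      apply Complex.ext <;> simp [hsdef]
      ring
    rw [this, norm_mul, Complex.norm_real, Complex.norm_I, hti, Real.norm_eq_abs, abs_mul, abs_mul]
    rw [abs_of_nonneg (by positivity : (0 : ℝ) ≤ ((N + 2 : ℕ) : ℝ))]
    simp
  have hy : 0 < |(u / (u - 1)).im| := abs_pos.2 (div_sub_one_im_ne_zero hu0)
  have hst : s ≠ t := by
    rw [← sub_ne_zero, ← norm_pos_iff, hd]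
    positivity
  obtain ⟨A, hA, hA'⟩ := hasSum_toeplitzWeight_mul_charRatio hm h1 h0 (N + 1) ht
  obtain ⟨I, E, hI, hD, hE⟩ :=
    hasSum_toeplitzWeight_mul_charRatio_mul_charRatio hm h1 h0 N hs ht hst
  have hB : HasSum (fun m : ℤ => (φ m : ℂ) *
      charRatio (fun j : Fin (N + 2) => m + (j : ℕ)) s) (starRingEnd ℂ A) := by
    have := (Complex.hasSum_conj' (f := fun m : ℤ => (φ m : ℂ) *
      charRatio (fun j : Fin (N + 2) => m + (j : ℕ)) t)).2 hA
    refine this.congr_fun fun m => ?_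
    rw [hsdef, charRatio_conj, map_mul, Complex.conj_ofReal]
  have hB' : HasSum (fun l => (toeplitzWeight φ (N + 2) l : ℂ) * charRatio l s)
      (starRingEnd ℂ A) := by
    have := (Complex.hasSum_conj' (f := fun l => (toeplitzWeight φ (N + 2) l : ℂ) *
      charRatio l t)).2 hA'
    refine this.congr_fun fun m => ?_
    rw [hsdef, charRatio_conj, map_mul, Complex.conj_ofReal]
  have hle := norm_moment_sub_mul_le hm h1 h0 (s - t)
    (R := fun m => charRatio (fun j : Fin (N + 2) => m + (j : ℕ)) s)
    (S := fun m => charRatio (fun j : Fin (N + 2) => m + (j : ℕ)) t)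
    (norm_charRatio_shift_le_one _ hs hsr) (norm_charRatio_shift_le_one _ ht htr) hB hA
    (I := I) (fun m => (hI m).congr_fun fun n => by ring) hD
  rw [← mul_sub, norm_mul, hd] at hle
  have hV : HasSum (fun l => ((toeplitzWeight φ (N + 2) l * ‖charRatio l t - A‖ ^ 2 : ℝ) : ℂ))
      (E - starRingEnd ℂ A * A) := by
    have hw := Complex.hasSum_ofReal.2 (hasSum_toeplitzWeight hm h1 (N + 2))
    have h5 := ((hE.sub (hB'.mul_right A)).sub (hA'.mul_left (starRingEnd ℂ A))).add
      (hw.mul_right (starRingEnd ℂ A * A))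
    have e : E - starRingEnd ℂ A * A - starRingEnd ℂ A * A + ((1 : ℝ) : ℂ) * (starRingEnd ℂ A * A) =
        E - starRingEnd ℂ A * A := by push_cast; ring
    rw [e] at h5
    refine h5.congr_fun fun l => ?_
    push_cast
    rw [← Complex.conj_mul', map_sub, ← charRatio_conj]
    ring
  refine ⟨A, (E - starRingEnd ℂ A * A).re, hA, ?_, ?_⟩
  · simpa only [Complex.ofReal_re] using Complex.hasSum_re hV
  · have h6 := Complex.re_le_norm (E - starRingEnd ℂ A * A)
    rw [div_div, le_div_iff₀ (by positivity)]
    nlinarith [mul_le_mul_of_nonneg_right h6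
      (by positivity : 0 ≤ ((N : ℝ) + 2) * |(u / (u - 1)).im|)]

theorem exists_tendsto_toeplitzWeight_variance (hφ : TotallyPositive φ) (h1 : HasSum φ 1)
    {u : ℂ} (hu : ‖u‖ = 1) (hu0 : u.im ≠ 0) :
    ∃ V : ℕ → ℝ, (∀ N, HasSum (fun l => toeplitzWeight φ (N + 2) l *
        ‖charRatio l (circleParam (N + 2) u) - ∑' m : ℤ, (φ m : ℂ) * u ^ m‖ ^ 2) (V N)) ∧
      Tendsto V atTop (𝓝 0) := by
  have h0 := hφ.nonneg
  have hm := hφ.summable_abs_pow_mul h1.summable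
  choose A V hA hV hVle using fun N =>
    exists_hasSum_toeplitzWeight_variance hm h1 h0 N hu hu0
  set F := ∑' m : ℤ, (φ m : ℂ) * u ^ m with hF
  have hAF : Tendsto A atTop (𝓝 F) := by
    have h2 := tendsto_tsum_of_dominated_convergence (𝓕 := atTop) (bound := φ)
      (f := fun (N : ℕ) (m : ℤ) => (φ m : ℂ) *
        charRatio (fun j : Fin (N + 2) => m + (j : ℕ)) (circleParam (N + 2) u))
      (g := fun m => (φ m : ℂ) * u ^ m) h1.summable
      (fun m => ((tendsto_charRatio_shift hu0 m).comp (tendsto_add_atTop_nat 2)).const_mul _)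
      (Eventually.of_forall fun N m => ?_)
    · exact h2.congr fun N => (hA N).tsum_eq
    · rw [norm_mul, Complex.norm_real,
      Real.norm_of_nonneg (h0 m)]
      exact mul_le_of_le_one_right (h0 m) (norm_charRatio_shift_le_one _
        (circleParam_im_ne_zero (by omega) hu0)
        (circleParam_re _ hu (ne_one_of_im_ne_zero hu0)) m)
  have hw := fun N => toeplitzWeight_nonneg hφ N
  have hbd : ∀ N l, toeplitzWeight φ (N + 2) l * ‖charRatio l (circleParam (N + 2) u) - F‖ ^ 2 ≤
      2 * (toeplitzWeight φ (N + 2) l * ‖charRatio l (circleParam (N + 2) u) - A N‖ ^ 2) +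
        2 * ‖A N - F‖ ^ 2 * toeplitzWeight φ (N + 2) l := fun N l => by
    have h3 : ‖charRatio l (circleParam (N + 2) u) - F‖ ≤
        ‖charRatio l (circleParam (N + 2) u) - A N‖ + ‖A N - F‖ :=
          norm_sub_le_norm_sub_add_norm_sub _ _ _
    have h4 := pow_le_pow_left₀ (norm_nonneg _) h3 2
    have h5 := add_sq_le (a := ‖charRatio l (circleParam (N + 2) u) - A N‖) (b := ‖A N - F‖)
    nlinarith [mul_le_mul_of_nonneg_left (h4.trans h5) (hw (N + 2) l)]
  have hbs := fun N => ((hV N).mul_left 2).add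
    ((hasSum_toeplitzWeight hm h1 (N + 2)).mul_left (2 * ‖A N - F‖ ^ 2))
  have hnn : ∀ N l, 0 ≤ toeplitzWeight φ (N + 2) l *
      ‖charRatio l (circleParam (N + 2) u) - F‖ ^ 2 := fun N l =>
    mul_nonneg (hw _ _) (sq_nonneg _)
  have hsum := fun N => (hbs N).summable.of_nonneg_of_le (hnn N) (hbd N)
  refine ⟨_, fun N => (hsum N).hasSum, ?_⟩
  have hlim : Tendsto (fun N : ℕ => 2 * (((∑' n : ℤ, |(n : ℝ)| * φ n) / |(u / (u - 1)).im|) /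
      (N + 2)) + 2 * ‖A N - F‖ ^ 2 * 1) atTop (𝓝 0) := by
    have h7 := ((tendsto_const_div_atTop_nhds_zero_nat
      ((∑' n : ℤ, |(n : ℝ)| * φ n) / |(u / (u - 1)).im|)).comp (tendsto_add_atTop_nat
        2)).const_mul 2
    have h8 := (((hAF.sub_const F).norm.pow 2).const_mul 2).mul_const 1
    simpa using h7.add h8
  refine squeeze_zero (fun N => tsum_nonneg (hnn N)) (fun N => ?_) hlim
  refine (hasSum_le (hbd N) (hsum N).hasSum (hbs N)).trans ?_
  have := hVle N
  linarith

end

theorem exists_antitone_tprod_eq {ι : Type*} (S : Finset ι) (g : ι → ℝ) (hg : ∀ a ∈ S, 0 ≤ g a) :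
    ∃ x : ℕ → ℝ, Antitone x ∧ (∀ i, 0 ≤ x i) ∧ (∀ i, x i = 0 ∨ ∃ a ∈ S, x i = g a) ∧ Summable x ∧
      ∀ f : ℝ → ℂ, f 0 = 1 → ∏' i, f (x i) = ∏ a ∈ S, f (g a) := by
  set L := (S.val.map g).sort (· ≥ ·) with hL
  have hmem : ∀ y ∈ L, ∃ a ∈ S, y = g a := fun y hy => by
    rw [hL, Multiset.mem_sort, Multiset.mem_map] at hy
    obtain ⟨a, ha, rfl⟩ := hy
    exact ⟨a, ha, rfl⟩
  have hpw : L.Pairwise (· ≥ ·) := Multiset.pairwise_sort _ _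
  have hz : ∀ i, L.length ≤ i → L.getD i 0 = 0 := fun i hi => List.getD_eq_default _ _ hi
  have hget : ∀ i (hi : i < L.length), L.getD i 0 = L[i] := fun i hi =>
    List.getD_eq_getElem _ _ hi
  have hor : ∀ i, L.getD i 0 = 0 ∨ ∃ a ∈ S, L.getD i 0 = g a := fun i => by
    rcases lt_or_ge i L.length with hi | hi
    · right
      rw [hget i hi]
      exact hmem _ (List.getElem_mem hi)
    · exact Or.inl (hz i hi)
  have hnn : ∀ i, 0 ≤ L.getD i 0 := fun i => by
    rcases hor i with h | ⟨a, ha, h⟩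
    · exact h.ge
    · exact (hg a ha).trans_eq h.symm
  refine ⟨fun i => L.getD i 0, fun i j hij => ?_, hnn, hor, ?_, fun f hf => ?_⟩
  · rcases lt_or_ge j L.length with hj | hj
    · show L.getD j 0 ≤ L.getD i 0
      rw [hget j hj, hget i (hij.trans_lt hj)]
      rcases hij.eq_or_lt with rfl | hij
      · exact le_rfl
      · exact List.pairwise_iff_getElem.1 hpw i j _ _ hij
    · exact (hz j hj).trans_le (hnn i)
  · refine summable_of_ne_finset_zero (s := Finset.range L.length) fun i hi => ?_
    exact hz i (by simpa using hi)
  · rw [tprod_eq_prod (s := Finset.range L.length) fun i hi => by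
      show f (L.getD i 0) = 1
      rw [hz i (by simpa using hi), hf]]
    have h1 : ∏ i ∈ Finset.range L.length, f (L.getD i 0) = (L.map f).prod := by
      rw [← Fin.prod_univ_eq_prod_range (fun i => f (L.getD i 0)), ← Fin.prod_univ_fun_getElem]
      exact Finset.prod_congr rfl fun i _ => by rw [hget i i.2]
    rw [h1, ← Multiset.prod_coe, ← Multiset.map_coe, hL, Multiset.sort_eq, Multiset.map_map]
    rfl

/-- The Edrei parameter contributed by the integer `a`, as a hole (`k = true`) or a particle
(`k = false`), on the side `s`. -/
noncomputable def pointParam (N : ℕ) (s k : Bool) (a : ℤ) : ℝ :=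
  (if s then 1 - ((a : ℝ) + 1 / 2) / N else ((a : ℝ) + 1 / 2) / N) * (if k then 1 else -1)

theorem sub_circleParam {N : ℕ} (hN : N ≠ 0) {u : ℂ} (hu0 : u ≠ 0) (hu1 : u ≠ 1)
    (s k : Bool) (a : ℤ) :
    (if k then (a : ℂ) - circleParam N u else ((a : ℂ) - circleParam N u)⁻¹) =
      (if k then (-N / (u - 1)) else (-N / (u - 1))⁻¹) *
        ((if s then 1 else if k then u else u⁻¹) *
          edreiFactor k (pointParam N s k a * edreiPoint s u)) := by
  have hN' : (N : ℂ) ≠ 0 := by exact_mod_cast hN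
  have hu := sub_ne_zero.2 hu1
  have h1 : (a : ℂ) - circleParam N u =
      (-N / (u - 1)) * (1 + (1 - (a + 1 / 2) / N : ℂ) * (u - 1)) := by
    rw [circleParam]
    field_simp
    ring
  have h2 : (a : ℂ) - circleParam N u =
      (-N / (u - 1)) * (u * (1 + ((a + 1 / 2) / N : ℂ) * (u⁻¹ - 1))) := by
    rw [circleParam]
    field_simp
    ring
  cases s <;> cases k
  · rw [h2]
    simp [edreiFactor, edreiPoint, pointParam]
    ring
  · rw [h2]
    simp [edreiFactor, edreiPoint, pointParam]
  · rw [h1]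
    simp [edreiFactor, edreiPoint, pointParam]
    ring
  · rw [h1]
    simp [edreiFactor, edreiPoint, pointParam]

theorem charRatio_eq_zpow_mul_edreiProd {N : ℕ} (hN : N ≠ 0) {l : Fin N → ℤ}
    (hl : Function.Injective l) : ∃ (n : ℤ) (x : Bool → Bool → ℕ → ℝ),
      (∀ s k i, 0 ≤ x s k i) ∧ (∀ s k, Antitone (x s k)) ∧ (∀ s k, Summable (x s k)) ∧
      (∀ s i, x s true i ≤ 1 / 2) ∧ ∀ u : ℂ, ‖u‖ = 1 → u.im ≠ 0 →
        charRatio l (circleParam N u) = u ^ n * edreiProd x u := by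
  classical
  have hNpos : (0 : ℝ) < N := by positivity
  set I : Finset ℤ := Finset.univ.image fun i : Fin N => ((i : ℕ) : ℤ) with hI
  set L : Finset ℤ := Finset.univ.image l with hL
  have hinj : Function.Injective fun i : Fin N => ((i : ℕ) : ℤ) := fun i j h => by
    simpa [Fin.ext_iff] using h
  have hmemI : ∀ a, a ∈ I ↔ 0 ≤ a ∧ a < N := fun a => by
    simp only [hI, Finset.mem_image, Finset.mem_univ, true_and]
    constructor
    · rintro ⟨i, rfl⟩
      have := i.2
      omega
    · rintro ⟨h0, h1⟩
      exact ⟨⟨a.toNat, by omega⟩, by simp [h0]⟩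
  have hcard : (I \ L).card = (L \ I).card := by
    have h1 := Finset.card_sdiff_add_card_inter I L
    have h2 := Finset.card_sdiff_add_card_inter L I
    have h3 : I.card = L.card := by
      rw [hI, hL, Finset.card_image_of_injective _ hinj, Finset.card_image_of_injective _ hl]
    rw [Finset.inter_comm] at h2
    omega
  set T : Bool → Finset ℤ := fun k => if k then I \ L else L \ I with hT
  set S : Bool → Bool → Finset ℤ := fun s k =>
    (T k).filter fun a => if s then (N : ℤ) ≤ 2 * a + 1 else ¬ (N : ℤ) ≤ 2 * a + 1 with hS
  have hS_nonneg : ∀ s k, ∀ a ∈ S s k, 0 ≤ pointParam N s k a := fun s k a ha => by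
    simp only [hS, hT, Finset.mem_filter] at ha
    obtain ⟨ha, hs⟩ := ha
    cases s <;> cases k <;> simp only [Finset.mem_sdiff, hmemI, if_true, if_false,
        Bool.false_eq_true] at ha hs <;>
      simp only [pointParam, if_true, if_false, Bool.false_eq_true, mul_one, mul_neg, neg_nonneg,
        sub_nonneg, tsub_nonpos]
    · have : a + 1 ≤ 0 := by omega
      have : (a : ℝ) + 1 ≤ 0 := by exact_mod_cast this
      exact div_nonpos_of_nonpos_of_nonneg (by linarith) hNpos.le
    · have : (0 : ℝ) ≤ a := by exact_mod_cast ha.1.1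
      positivity
    · have : (N : ℤ) ≤ a := by omega
      have : (N : ℝ) ≤ a := by exact_mod_cast this
      rw [one_le_div hNpos]
      linarith
    · have : a + 1 ≤ (N : ℤ) := by omega
      have : (a : ℝ) + 1 ≤ N := by exact_mod_cast this
      rw [div_le_one hNpos]
      linarith
  have hS_le : ∀ s, ∀ a ∈ S s true, pointParam N s true a ≤ 1 / 2 := fun s a ha => by
    simp only [hS, hT, Finset.mem_filter] at ha
    obtain ⟨ha, hs⟩ := ha
    cases s <;> simp only [if_true, if_false, Bool.false_eq_true] at hs <;>
      simp only [pointParam, if_true, if_false, Bool.false_eq_true, mul_one]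
    · have : 2 * a + 1 ≤ (N : ℤ) := by omega
      have : 2 * (a : ℝ) + 1 ≤ N := by exact_mod_cast this
      rw [div_le_iff₀ hNpos]
      linarith
    · have : (N : ℝ) ≤ 2 * a + 1 := by exact_mod_cast hs
      have h2 : 1 / 2 ≤ ((a : ℝ) + 1 / 2) / N := by
        rw [le_div_iff₀ hNpos]
        linarith
      linarith
  choose x hx1 hx2 hx3 hx4 hx5 using fun s k => exists_antitone_tprod_eq (S s k) (pointParam N s k)
    (hS_nonneg s k)
  refine ⟨(S false true).card - (S false false).card, x, hx2, hx1, hx4, fun s i => ?_,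
    fun u hu hu0 => ?_⟩
  · rcases hx3 s true i with h | ⟨a, ha, h⟩
    · rw [h]; norm_num
    · rw [h]; exact hS_le s a ha
  · have hu0' : u ≠ 0 := fun h => hu0 (by simp [h])
    have hu1 := ne_one_of_im_ne_zero hu0
    have ht := circleParam_im_ne_zero hN hu0
    have hE : edreiProd x u =
        (∏ s, ∏ a ∈ S s true, edreiFactor true (pointParam N s true a * edreiPoint s u)) *
        ∏ s, ∏ a ∈ S s false, edreiFactor false (pointParam N s false a * edreiPoint s u) := by
      rw [← Fintype.prod_bool fun k => ∏ s, ∏ a ∈ S s k,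
        edreiFactor k (pointParam N s k a * edreiPoint s u), Finset.prod_comm]
      refine Finset.prod_congr rfl fun s _ => Finset.prod_congr rfl fun k _ => ?_
      exact hx5 s k (fun y => edreiFactor k (y * edreiPoint s u)) (by simp [edreiFactor_zero])
    have hK : (-N / (u - 1) : ℂ) ≠ 0 :=
      div_ne_zero (neg_ne_zero.2 (by exact_mod_cast hN)) (sub_ne_zero.2 hu1)
    have hside : ∀ k, (∏ a ∈ T k,
        (if k then (a : ℂ) - circleParam N u else ((a : ℂ) - circleParam N u)⁻¹)) =
        (if k then (-N / (u - 1)) else (-N / (u - 1))⁻¹) ^ (T k).card *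
        ((if k then u else u⁻¹) ^ (S false k).card *
        ∏ s, ∏ a ∈ S s k, edreiFactor k (pointParam N s k a * edreiPoint s u)) := fun k => by
      have h1 : ∀ s, ∏ a ∈ S s k,
          (if k then (a : ℂ) - circleParam N u else ((a : ℂ) - circleParam N u)⁻¹) =
          (if k then (-N / (u - 1)) else (-N / (u - 1))⁻¹) ^ (S s k).card *
          ((if s then 1 else if k then u else u⁻¹) ^ (S s k).card *
          ∏ a ∈ S s k, edreiFactor k (pointParam N s k a * edreiPoint s u)) := fun s => by
        rw [Finset.prod_congr rfl fun a _ => sub_circleParam hN hu0' hu1 s k a,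
          Finset.prod_mul_distrib, Finset.prod_mul_distrib, Finset.prod_const, Finset.prod_const]
      have h2 := Finset.prod_filter_mul_prod_filter_not (T k) (fun a : ℤ => (N : ℤ) ≤ 2 * a + 1)
        fun a : ℤ => (if k then (a : ℂ) - circleParam N u else ((a : ℂ) - circleParam N u)⁻¹)
      have h3 : (S true k).card + (S false k).card = (T k).card := by
        simpa [hS] using Finset.card_filter_add_card_filter_not (s := T k)
          (fun a : ℤ => (N : ℤ) ≤ 2 * a + 1)
      have h4 := h1 true
      have h5 := h1 false
      simp only [hS, if_true, if_false, Bool.false_eq_true] at h4 h5 h3 ⊢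
      rw [← h2, h4, h5, ← h3, Fintype.prod_bool]
      simp only [if_true, if_false, Bool.false_eq_true]
      ring
    have hne : ∀ a : ℤ, (a : ℂ) - circleParam N u ≠ 0 := intCast_sub_ne_zero ht
    have hchar : charRatio l (circleParam N u) =
        (∏ a ∈ T true, ((a : ℂ) - circleParam N u)) *
          ∏ a ∈ T false, ((a : ℂ) - circleParam N u)⁻¹ := by
      have h1 : (∏ i : Fin N, (((i : ℕ) : ℂ) - circleParam N u)) =
          ∏ a ∈ I, ((a : ℂ) - circleParam N u) := by
        rw [hI, Finset.prod_image fun i _ j _ h => hinj h]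
        simp
      have h2 : (∏ i : Fin N, ((l i : ℂ) - circleParam N u)⁻¹) =
          ∏ a ∈ L, ((a : ℂ) - circleParam N u)⁻¹ := by
        rw [hL, Finset.prod_image fun i _ j _ h => hl h]
      rw [charRatio_eq, h1, h2, ← Finset.prod_inter_mul_prod_sdiff I L,
        ← Finset.prod_inter_mul_prod_sdiff L I, Finset.inter_comm L I]
      have h3 : (∏ a ∈ I ∩ L, ((a : ℂ) - circleParam N u)) *
          ∏ a ∈ I ∩ L, ((a : ℂ) - circleParam N u)⁻¹ = 1 := by
        rw [← Finset.prod_mul_distrib]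
        exact Finset.prod_eq_one fun a _ => mul_inv_cancel₀ (hne a)
      simp only [hT, if_true, if_false, Bool.false_eq_true]
      linear_combination (∏ a ∈ I \ L, ((a : ℂ) - circleParam N u)) *
          (∏ a ∈ L \ I, ((a : ℂ) - circleParam N u)⁻¹) * h3
    have h1 := hside true
    have h2 := hside false
    have h3 : (T true).card = (T false).card := by simpa [hT] using hcard
    simp only [if_true, if_false, Bool.false_eq_true] at h1 h2
    have h4 : (-N / (u - 1) : ℂ) ^ (T false).card *
        ((-N / (u - 1) : ℂ)⁻¹) ^ (T false).card = 1 := by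
      rw [← mul_pow, mul_inv_cancel₀ hK, one_pow]
    rw [hchar, h1, h2, hE, h3, zpow_sub₀ hu0', zpow_natCast, zpow_natCast,
      div_eq_mul_inv (u ^ (S false true).card), ← inv_pow]
    linear_combination (u ^ (S false true).card *
        ∏ s, ∏ a ∈ S s true, edreiFactor true (pointParam N s true a * edreiPoint s u)) *
      (u⁻¹ ^ (S false false).card *
        ∏ s, ∏ a ∈ S s false, edreiFactor false (pointParam N s false a * edreiPoint s u)) * h4

theorem edreiPoint_re_and_normSq (s : Bool) {u : ℂ} (hu : ‖u‖ = 1) :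
    (edreiPoint s u).re = -(1 - u.re) ∧ Complex.normSq (edreiPoint s u) = 2 * (1 - u.re) := by
  have h2 : Complex.normSq u = 1 := by rw [Complex.normSq_eq_norm_sq, hu, one_pow]
  have h3 : u⁻¹ = starRingEnd ℂ u := by rw [Complex.inv_def, h2]; simp
  rw [Complex.normSq_apply] at h2
  cases s
  · simp only [edreiPoint, Bool.false_eq_true, if_false, h3, Complex.normSq_apply]
    simp
    linarith
  · simp only [edreiPoint, if_true, Complex.normSq_apply]
    simp
    linarith

theorem norm_sq_edreiFactor_mul_le (s k : Bool) {x : ℝ} (hx : 0 ≤ x) (hxk : k = true → x ≤ 1 / 2)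
    {u : ℂ} (hu : ‖u‖ = 1) :
    ‖edreiFactor k (x * edreiPoint s u)‖ ^ 2 * (1 + x * (1 - u.re)) ≤ 1 := by
  obtain ⟨h1, h2⟩ := edreiPoint_re_and_normSq s hu
  have h3 : 0 ≤ 1 - u.re := by linarith [hu ▸ Complex.re_le_norm u]
  have h4 : 0 ≤ x * (1 - u.re) := mul_nonneg hx h3
  rw [Complex.normSq_apply] at h2
  rw [← Complex.normSq_eq_norm_sq]
  cases k
  · have h5 : Complex.normSq (1 - x * edreiPoint s u) =
        1 + 2 * x * (1 - u.re) + x ^ 2 * (2 * (1 - u.re)) := by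
      rw [← h2, Complex.normSq_apply]
      simp
      linear_combination (-2 * x) * h1
    simp only [edreiFactor, Bool.false_eq_true, if_false, map_inv₀, h5]
    rw [inv_mul_le_one₀ (by nlinarith [mul_nonneg hx h4])]
    nlinarith [mul_nonneg hx h4]
  · have h5 : Complex.normSq (1 + x * edreiPoint s u) =
        1 - 2 * x * (1 - u.re) + x ^ 2 * (2 * (1 - u.re)) := by
      rw [← h2, Complex.normSq_apply]
      simp
      linear_combination (2 * x) * h1
    simp only [edreiFactor, if_true, h5]
    have h6 := mul_nonneg h4 (sub_nonneg.2 (hxk rfl))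
    nlinarith [mul_nonneg h6 h4, mul_nonneg h6 (by norm_num : (0:ℝ) ≤ 2)]

theorem one_add_sum_range_le_prod {x : ℕ → ℝ} (hx : ∀ i, 0 ≤ x i) (n : ℕ) :
    1 + ∑ i ∈ Finset.range n, x i ≤ ∏ i ∈ Finset.range n, (1 + x i) := by
  induction n with
  | zero => simp
  | succ n ih =>
    rw [Finset.sum_range_succ, Finset.prod_range_succ]
    have := Finset.sum_nonneg fun i (_ : i ∈ Finset.range n) => hx i
    nlinarith [hx n, mul_le_mul_of_nonneg_right ih (hx n)]

section
variable {x : Bool → Bool → ℕ → ℝ} (hx : ∀ s k i, 0 ≤ x s k i) (hxs : ∀ s k, Summable (x s k))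
  (hx1 : ∀ s i, x s true i ≤ 1 / 2)
include hx hxs hx1

theorem norm_sq_tprod_edreiFactor_mul_le (s k : Bool) {u : ℂ} (hu : ‖u‖ = 1) (n : ℕ) :
    ‖∏' i, edreiFactor k (x s k i * edreiPoint s u)‖ ^ 2 *
      (1 + (1 - u.re) * ∑ i ∈ Finset.range n, x s k i) ≤ 1 := by
  have hκ : 0 ≤ 1 - u.re := by linarith [hu ▸ Complex.re_le_norm u]
  have h := (multipliable_edreiFactor k (hx s k) (hxs s k)
    (edreiPoint_re_nonpos s hu)).hasProd.tendsto_prod_nat.norm.pow 2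
  have hfac := fun i => norm_sq_edreiFactor_mul_le s k (hx s k i)
    (fun hk => by subst hk; exact hx1 s i) hu
  refine le_of_tendsto (h.mul_const _) ?_
  filter_upwards [eventually_ge_atTop n] with m hm
  rw [norm_prod, ← Finset.prod_pow]
  have h1 : 1 + (1 - u.re) * ∑ i ∈ Finset.range n, x s k i ≤
      ∏ i ∈ Finset.range m, (1 + x s k i * (1 - u.re)) := by
    refine le_trans ?_ (one_add_sum_range_le_prod (fun i => mul_nonneg (hx s k i) hκ) m)
    rw [← Finset.sum_mul, mul_comm]
    gcongr
    exact fun i _ _ => hx s k i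
  refine (mul_le_mul_of_nonneg_left h1 (by positivity)).trans ?_
  rw [← Finset.prod_mul_distrib]
  exact Finset.prod_le_one (fun i _ => mul_nonneg (sq_nonneg _)
    (by nlinarith [mul_nonneg (hx s k i) hκ])) fun i _ => hfac i

theorem norm_tprod_edreiFactor_le_one (s k : Bool) {u : ℂ} (hu : ‖u‖ = 1) :
    ‖∏' i, edreiFactor k (x s k i * edreiPoint s u)‖ ≤ 1 := by
  have := norm_sq_tprod_edreiFactor_mul_le hx hxs hx1 s k hu 0
  rw [Finset.sum_range_zero, mul_zero, add_zero, mul_one] at this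
  exact (sq_le_one_iff₀ (norm_nonneg _)).1 this

theorem norm_edreiProd_le_norm_tprod (s k : Bool) {u : ℂ} (hu : ‖u‖ = 1) :
    ‖edreiProd x u‖ ≤ ‖∏' i, edreiFactor k (x s k i * edreiPoint s u)‖ := by
  have h := fun s k => norm_tprod_edreiFactor_le_one hx hxs hx1 s k hu
  have h0 : ∀ s, 0 ≤ ∏ k, ‖∏' i, edreiFactor k (x s k i * edreiPoint s u)‖ := fun s =>
    Finset.prod_nonneg fun _ _ => norm_nonneg _
  have h1 : ∀ s, ∏ k, ‖∏' i, edreiFactor k (x s k i * edreiPoint s u)‖ ≤ 1 := fun s =>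
    Finset.prod_le_one (fun _ _ => norm_nonneg _) fun k _ => h s k
  have h2 : ∏ k, ‖∏' i, edreiFactor k (x s k i * edreiPoint s u)‖ ≤
      ‖∏' i, edreiFactor k (x s k i * edreiPoint s u)‖ := by
    rw [Fintype.prod_bool]
    cases k
    · exact mul_le_of_le_one_left (norm_nonneg _) (h s true)
    · exact mul_le_of_le_one_right (norm_nonneg _) (h s false)
  simp only [edreiProd, norm_prod]
  refine le_trans ?_ h2
  rw [Fintype.prod_bool]
  cases s
  · exact mul_le_of_le_one_left (h0 false) (h1 true)
  · exact mul_le_of_le_one_right (h0 true) (h1 false)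

theorem norm_edreiProd_le_one {u : ℂ} (hu : ‖u‖ = 1) : ‖edreiProd x u‖ ≤ 1 :=
  (norm_edreiProd_le_norm_tprod hx hxs hx1 true true hu).trans
    (norm_tprod_edreiFactor_le_one hx hxs hx1 _ _ hu)

theorem tsum_le_of_le_norm_edreiProd {u : ℂ} (hu : ‖u‖ = 1) (hu1 : u.re < 1) {c : ℝ} (hc : 0 < c)
    (hcx : c ≤ ‖edreiProd x u‖) (s k : Bool) : ∑' i, x s k i ≤ (c ^ 2 * (1 - u.re))⁻¹ := by
  refine Real.tsum_le_of_sum_range_le (hx s k) fun n => ?_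
  have h1 := norm_sq_tprod_edreiFactor_mul_le hx hxs hx1 s k hu n
  have h2 := pow_le_pow_left₀ hc.le (hcx.trans (norm_edreiProd_le_norm_tprod hx hxs hx1 s k hu)) 2
  have h3 : 0 ≤ ∑ i ∈ Finset.range n, x s k i := Finset.sum_nonneg fun i _ => hx s k i
  have h4 : 0 < 1 - u.re := sub_pos.2 hu1
  rw [← mul_one (_ ⁻¹), le_inv_mul_iff₀ (by positivity)]
  nlinarith [mul_le_mul_of_nonneg_right h2 (by positivity :
    0 ≤ 1 + (1 - u.re) * ∑ i ∈ Finset.range n, x s k i), sq_nonneg c]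

end

theorem ae_exp_ofReal_mul_I_im_ne_zero : ∀ᵐ θ : ℝ, (Complex.exp (θ * Complex.I)).im ≠ 0 := by
  have h : (Set.range fun n : ℤ => (n : ℝ) * Real.pi).Countable := Set.countable_range _
  filter_upwards [h.ae_notMem volume] with θ hθ h0
  rw [Complex.exp_ofReal_mul_I_im, Real.sin_eq_zero_iff] at h0
  exact hθ h0

theorem norm_charRatio_circleParam_le_one {N : ℕ} (hN : N ≠ 0) {l : Fin N → ℤ}
    (hl : Function.Injective l) {u : ℂ} (hu : ‖u‖ = 1) (hu0 : u.im ≠ 0) :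
    ‖charRatio l (circleParam N u)‖ ≤ 1 := by
  obtain ⟨n, x, hx, -, hxs, hx1, h⟩ := charRatio_eq_zpow_mul_edreiProd hN hl
  rw [h u hu hu0, norm_mul, norm_zpow, hu, one_zpow, one_mul]
  exact norm_edreiProd_le_one hx hxs hx1 hu

theorem measurable_charRatio_circleParam {N : ℕ} (l : Fin N → ℤ) :
    Measurable fun u : ℂ => charRatio l (circleParam N u) := by
  unfold charRatio circleParam
  fun_prop

theorem norm_tsum_mul_zpow_le_one {φ : ℤ → ℝ} (h0 : ∀ n, 0 ≤ φ n) (h1 : HasSum φ 1) {u : ℂ}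
    (hu : ‖u‖ = 1) : ‖∑' m : ℤ, (φ m : ℂ) * u ^ m‖ ≤ 1 :=
  tsum_of_norm_bounded h1 fun m => by simp [hu, abs_of_nonneg (h0 m)]

theorem continuous_tsum_mul_exp_zpow {φ : ℤ → ℝ} (h0 : ∀ n, 0 ≤ φ n) (h1 : Summable φ) :
    Continuous fun θ : ℝ => ∑' m : ℤ, (φ m : ℂ) * Complex.exp (θ * Complex.I) ^ m :=
  continuous_tsum (fun m => continuous_const.mul (continuous_exp_zpow m)) h1 fun m θ => by
    rw [norm_mul, norm_exp_ofReal_mul_I_zpow, mul_one, Complex.norm_real,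
      Real.norm_of_nonneg (h0 m)]

theorem exists_toeplitzWeight_ne_zero_le {ι : Type*} {c : ι → ℝ} (hc : ∀ l, 0 ≤ c l)
    (hc1 : HasSum c 1) {a : ι → ENNReal} (hfin : ∑' l, ENNReal.ofReal (c l) * a l ≠ ⊤)
    {δ : ENNReal} (hδ : δ ≠ 0) :
    ∃ l, c l ≠ 0 ∧ a l ≤ ∑' l, ENNReal.ofReal (c l) * a l + δ := by
  by_contra! h
  have h1 : ∑' l, ENNReal.ofReal (c l) = 1 := by
    rw [← ENNReal.ofReal_tsum_of_nonneg hc hc1.summable, hc1.tsum_eq, ENNReal.ofReal_one]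
  have h2 : ∑' l, ENNReal.ofReal (c l) * a l + δ ≤ ∑' l, ENNReal.ofReal (c l) * a l := by
    calc ∑' l, ENNReal.ofReal (c l) * a l + δ
        = ∑' l, ENNReal.ofReal (c l) * (∑' l, ENNReal.ofReal (c l) * a l + δ) := by
          rw [ENNReal.tsum_mul_right, h1, one_mul]
      _ ≤ _ := by
          refine ENNReal.tsum_le_tsum fun l => ?_
          rcases eq_or_ne (c l) 0 with h0 | h0
          · simp [h0]
          · gcongr
            exact (h l h0).le
  exact hδ (by simpa using ENNReal.le_of_add_le_add_left hfin (h2.trans_eq (add_zero _).symm))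

theorem exists_ae_tendsto_charRatio {φ : ℤ → ℝ} (hφ : TotallyPositive φ) (h1 : HasSum φ 1) :
    ∃ (M : ℕ → ℕ) (l : ∀ i, Fin (M i) → ℤ), (∀ i, M i ≠ 0) ∧ (∀ i, Function.Injective (l i)) ∧
      ∀ᵐ θ : ℝ ∂volume.restrict (Set.Ioc (-Real.pi) Real.pi),
        Tendsto (fun i => charRatio (l i) (circleParam (M i) (Complex.exp (θ * Complex.I)))) atTop
          (𝓝 (∑' m : ℤ, (φ m : ℂ) * Complex.exp (θ * Complex.I) ^ m)) := by
  have h0 := hφ.nonneg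
  have hm := hφ.summable_abs_pow_mul h1.summable
  set μ := volume.restrict (Set.Ioc (-Real.pi) Real.pi)
  set F : ℝ → ℂ := fun θ => ∑' m : ℤ, (φ m : ℂ) * Complex.exp (θ * Complex.I) ^ m with hF
  have hFm : Measurable F := (continuous_tsum_mul_exp_zpow h0 h1.summable).measurable
  have hexp : Measurable fun θ : ℝ => Complex.exp (θ * Complex.I) := by fun_prop
  have hXm : ∀ N (l : Fin N → ℤ), Measurable fun θ : ℝ =>
      ‖charRatio l (circleParam N (Complex.exp (θ * Complex.I))) - F θ‖ ^ 2 := fun N l =>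
    ((((measurable_charRatio_circleParam l).comp hexp).sub hFm).norm).pow_const 2
  have hgood : ∀ᵐ θ : ℝ ∂μ, (Complex.exp (θ * Complex.I)).im ≠ 0 :=
    ae_restrict_of_ae ae_exp_ofReal_mul_I_im_ne_zero
  have hw := fun N => toeplitzWeight_nonneg hφ N
  have hw1 := hasSum_toeplitzWeight hm h1
  have hInt : Tendsto (fun N => ∫⁻ θ : ℝ, ∑' l, ENNReal.ofReal (toeplitzWeight φ (N + 2) l) *
      ENNReal.ofReal (‖charRatio l (circleParam (N + 2) (Complex.exp (θ * Complex.I))) -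
        F θ‖ ^ 2) ∂μ) atTop (𝓝 0) := by
    rw [← lintegral_zero (μ := μ)]
    refine tendsto_lintegral_of_dominated_convergence (fun _ => 4) (fun N => ?_) (fun N => ?_) ?_ ?_
    · exact Measurable.tsum fun l => ((hXm _ l).ennreal_ofReal).const_mul _
    · filter_upwards [hgood] with θ hθ
      have hu := Complex.norm_exp_ofReal_mul_I θ
      have h4 : ∑' l, ENNReal.ofReal (toeplitzWeight φ (N + 2) l) * 4 = 4 := by
        rw [ENNReal.tsum_mul_right, ← ENNReal.ofReal_tsum_of_nonneg (hw _) (hw1 _).summable,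
          (hw1 _).tsum_eq, ENNReal.ofReal_one, one_mul]
      refine (ENNReal.tsum_le_tsum fun l => ?_).trans_eq h4
      rcases eq_or_ne (toeplitzWeight φ (N + 2) l) 0 with hl | hl
      · simp [hl]
      · gcongr
        rw [show (4 : ENNReal) = ENNReal.ofReal (2 ^ 2) by norm_num]
        refine ENNReal.ofReal_le_ofReal (pow_le_pow_left₀ (norm_nonneg _) ?_ 2)
        refine (norm_sub_le _ _).trans ?_
        have h5 := norm_charRatio_circleParam_le_one (by omega)
          (injective_of_toeplitzWeight_ne_zero hl) hu hθ
        have h6 := norm_tsum_mul_zpow_le_one h0 h1 hu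
        linarith
    · rw [lintegral_const, Measure.restrict_apply MeasurableSet.univ, Set.univ_inter,
        Real.volume_Ioc]
      exact ENNReal.mul_ne_top (by norm_num) ENNReal.ofReal_ne_top
    · filter_upwards [hgood] with θ hθ
      obtain ⟨V, hV, hV0⟩ := exists_tendsto_toeplitzWeight_variance hφ h1
        (Complex.norm_exp_ofReal_mul_I θ) hθ
      have h5 := ENNReal.tendsto_ofReal hV0
      rw [ENNReal.ofReal_zero] at h5
      refine h5.congr fun N => ?_
      rw [← (hV N).tsum_eq, ENNReal.ofReal_tsum_of_nonneg
        (fun l => mul_nonneg (hw _ _) (sq_nonneg _)) (hV N).summable]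
      exact tsum_congr fun l => ENNReal.ofReal_mul (hw _ _)
  have hswap : ∀ N, (∫⁻ θ : ℝ, ∑' l, ENNReal.ofReal (toeplitzWeight φ (N + 2) l) *
      ENNReal.ofReal (‖charRatio l (circleParam (N + 2) (Complex.exp (θ * Complex.I))) -
        F θ‖ ^ 2) ∂μ) = ∑' l, ENNReal.ofReal (toeplitzWeight φ (N + 2) l) *
      ∫⁻ θ : ℝ, ENNReal.ofReal (‖charRatio l (circleParam (N + 2) (Complex.exp (θ * Complex.I))) -
        F θ‖ ^ 2) ∂μ := fun N => by
    rw [lintegral_tsum fun l => ((hXm _ l).ennreal_ofReal.const_mul _).aemeasurable]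
    exact tsum_congr fun l => lintegral_const_mul _ (hXm _ l).ennreal_ofReal
  simp only [hswap] at hInt
  obtain ⟨K, hK⟩ := eventually_atTop.1 (hInt.eventually_lt_const (ENNReal.zero_lt_top))
  choose l hl hle using fun N => exists_toeplitzWeight_ne_zero_le (hw (N + K + 2)) (hw1 (N + K + 2))
    (hK (N + K) (by omega)).ne (δ := ENNReal.ofReal (1 / ((N : ℝ) + 1)))
    (by rw [ENNReal.ofReal_ne_zero_iff]; positivity)
  have hlim : Tendsto (fun N => ∫⁻ θ : ℝ, ENNReal.ofReal (‖charRatio (l N)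
      (circleParam (N + K + 2) (Complex.exp (θ * Complex.I))) - F θ‖ ^ 2) ∂μ) atTop (𝓝 0) := by
    have h6 := ENNReal.tendsto_ofReal (tendsto_one_div_add_atTop_nhds_zero_nat (𝕜 := ℝ))
    rw [ENNReal.ofReal_zero] at h6
    have h7 := (hInt.comp (tendsto_add_atTop_nat K)).add h6
    rw [add_zero] at h7
    exact tendsto_of_tendsto_of_tendsto_of_le_of_le tendsto_const_nhds h7 (fun _ => zero_le)
      hle
  have hmeas : TendstoInMeasure μ (fun N θ => ‖charRatio (l N)
      (circleParam (N + K + 2) (Complex.exp (θ * Complex.I))) - F θ‖ ^ 2) atTop 0 := by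
    refine tendstoInMeasure_of_tendsto_eLpNorm one_ne_zero
      (fun N => (hXm _ _).aestronglyMeasurable) aestronglyMeasurable_const ?_
    refine hlim.congr fun N => ?_
    rw [sub_zero, eLpNorm_one_eq_lintegral_enorm]
    refine lintegral_congr fun θ => ?_
    rw [Real.enorm_of_nonneg (sq_nonneg _)]
  obtain ⟨ns, -, hns⟩ := hmeas.exists_seq_tendsto_ae
  refine ⟨fun i => ns i + K + 2, fun i => l (ns i), fun i => by simp,
    fun i => injective_of_toeplitzWeight_ne_zero (hl _), ?_⟩
  filter_upwards [hns] with θ hθ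
  rw [tendsto_iff_norm_sub_tendsto_zero]
  have h8 := hθ.sqrt
  simpa [Real.sqrt_sq] using h8

theorem tendsto_integral_exp_zpow_mul (f : ℝ → ℂ) :
    Tendsto (fun n : ℤ => ∫ θ in Set.Ioc (-Real.pi) Real.pi, Complex.exp (θ * Complex.I) ^ n * f θ)
      cofinite (𝓝 0) := by
  have h := Real.tendsto_integral_exp_smul_cocompact ((Set.Ioc (-Real.pi) Real.pi).indicator f)
  have hc : Tendsto (fun n : ℤ => (n : ℝ) * (-(2 * Real.pi)⁻¹)) cofinite (cocompact ℝ) :=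
    (Homeomorph.mulRight₀ (-(2 * Real.pi)⁻¹) (neg_ne_zero.2 (inv_ne_zero
      Real.two_pi_pos.ne'))).isClosedEmbedding.tendsto_cocompact.comp Int.tendsto_coe_cofinite
  refine (h.comp hc).congr fun n => ?_
  simp only [Function.comp_apply]
  rw [← integral_indicator measurableSet_Ioc]
  refine integral_congr_ae (Eventually.of_forall fun θ => ?_)
  by_cases hθ : θ ∈ Set.Ioc (-Real.pi) Real.pi
  · simp only [Set.indicator_of_mem hθ, Circle.smul_def, Real.fourierChar_apply, smul_eq_mul,
      ← Complex.exp_int_mul]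
    congr 2
    have := Real.pi_ne_zero
    push_cast
    field_simp
  · simp [Set.indicator_of_notMem hθ]

theorem re_lt_one_of_norm_eq_one {u : ℂ} (hu : ‖u‖ = 1) (hu0 : u.im ≠ 0) : u.re < 1 := by
  have h := Complex.sq_norm u
  rw [hu, Complex.normSq_apply] at h
  nlinarith [mul_self_pos.2 hu0]

theorem exists_frequently_eq_of_ae_tendsto {F : ℂ → ℂ} {G : ℂ → ℂ}
    (hF : Continuous fun θ : ℝ => F (Complex.exp (θ * Complex.I))) (hF1 : F 1 ≠ 0)
    {P : ℕ → ℂ → ℂ} {n : ℕ → ℤ} (hP : ∀ i u, ‖u‖ = 1 → ‖P i u‖ ≤ 1)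
    (hPm : ∀ i, Continuous fun θ : ℝ => P i (Complex.exp (θ * Complex.I)))
    (hPG : ∀ u, ‖u‖ = 1 → Tendsto (fun i => P i u) atTop (𝓝 (G u)))
    (hlim : ∀ᵐ θ : ℝ ∂volume.restrict (Set.Ioc (-Real.pi) Real.pi),
      Tendsto (fun i => Complex.exp (θ * Complex.I) ^ n i * P i (Complex.exp (θ * Complex.I)))
        atTop (𝓝 (F (Complex.exp (θ * Complex.I))))) :
    ∃ m, ∃ᶠ i in atTop, n i = m := by
  by_contra! hcon
  have hn : Tendsto n atTop cofinite := le_cofinite_iff_eventually_ne.2 fun m => hcon m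
  set μ := volume.restrict (Set.Ioc (-Real.pi) Real.pi)
  have hu := Complex.norm_exp_ofReal_mul_I
  have hGle : ∀ u, ‖u‖ = 1 → ‖G u‖ ≤ 1 := fun u hu =>
    le_of_tendsto (hPG u hu).norm (Eventually.of_forall fun i => hP i u hu)
  have hGlim : ∀ᵐ θ : ℝ ∂μ, Tendsto (fun i => Complex.exp (θ * Complex.I) ^ n i *
      G (Complex.exp (θ * Complex.I))) atTop (𝓝 (F (Complex.exp (θ * Complex.I)))) := by
    filter_upwards [hlim] with θ hθ
    have h1 : Tendsto (fun i => Complex.exp (θ * Complex.I) ^ n i *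
        (P i (Complex.exp (θ * Complex.I)) - G (Complex.exp (θ * Complex.I)))) atTop (𝓝 0) := by
      rw [tendsto_zero_iff_norm_tendsto_zero]
      simp only [norm_mul, norm_exp_ofReal_mul_I_zpow, one_mul]
      exact tendsto_iff_norm_sub_tendsto_zero.1 (hPG _ (hu θ))
    have h2 := hθ.sub h1
    rw [sub_zero] at h2
    exact h2.congr fun i => by ring
  have hGm : Measurable fun θ : ℝ => G (Complex.exp (θ * Complex.I)) :=
    measurable_of_tendsto_metrizable (fun i => (hPm i).measurable)
      (tendsto_pi_nhds.2 fun θ => hPG _ (hu θ))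
  have hFle : ∀ᵐ θ : ℝ ∂μ, ‖F (Complex.exp (θ * Complex.I))‖ ≤ 1 := by
    filter_upwards [hGlim] with θ hθ
    refine le_of_tendsto hθ.norm (Eventually.of_forall fun i => ?_)
    rw [norm_mul, norm_exp_ofReal_mul_I_zpow, one_mul]
    exact hGle _ (hu θ)
  have hRL := (tendsto_integral_exp_zpow_mul fun θ : ℝ => G (Complex.exp (θ * Complex.I)) *
    starRingEnd ℂ (F (Complex.exp (θ * Complex.I)))).comp hn
  have hdom := tendsto_integral_of_dominated_convergence (μ := μ) (fun _ => (1 : ℝ))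
    (F := fun i (θ : ℝ) => Complex.exp (θ * Complex.I) ^ n i * (G (Complex.exp (θ * Complex.I)) *
      starRingEnd ℂ (F (Complex.exp (θ * Complex.I)))))
    (f := fun θ => F (Complex.exp (θ * Complex.I)) *
      starRingEnd ℂ (F (Complex.exp (θ * Complex.I))))
    (fun i => ((continuous_exp_zpow (n i)).measurable.mul (hGm.mul
      (Complex.continuous_conj.comp hF).measurable)).aestronglyMeasurable)
    (integrable_const _) (fun i => ?_) ?_
  · have h3 := tendsto_nhds_unique hdom hRL
    have h4 : ∀ z : ℂ, z * starRingEnd ℂ z = ((‖z‖ ^ 2 : ℝ) : ℂ) := fun z => by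
      rw [Complex.mul_conj']; push_cast; rfl
    simp only [h4] at h3
    rw [integral_complex_ofReal, Complex.ofReal_eq_zero, integral_eq_zero_iff_of_nonneg
      (fun θ => sq_nonneg _)] at h3
    · have h5 := Measure.eqOn_Ioc_of_ae_eq _ h3 (hF.norm.pow 2).continuousOn continuousOn_const
        (x := 0) ⟨by linarith [Real.pi_pos], Real.pi_pos.le⟩
      simp [hF1] at h5
    · refine Integrable.of_bound (hF.norm.pow 2).aestronglyMeasurable 1 ?_
      filter_upwards [hFle] with θ hθ
      rw [Real.norm_of_nonneg (sq_nonneg _)]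
      exact pow_le_one₀ (norm_nonneg _) hθ
  · filter_upwards [hFle] with θ hθ
    rw [norm_mul, norm_exp_ofReal_mul_I_zpow, one_mul, norm_mul, RCLike.norm_conj]
    exact mul_le_one₀ (hGle _ (hu θ)) (norm_nonneg _) hθ
  · filter_upwards [hGlim] with θ hθ
    exact (hθ.mul_const _).congr fun i => by ring

theorem exists_edrei_form_of_ae_tendsto {F : ℂ → ℂ}
    (hF : Continuous fun θ : ℝ => F (Complex.exp (θ * Complex.I))) (hF1 : F 1 ≠ 0)
    {n : ℕ → ℤ} {x : ℕ → Bool → Bool → ℕ → ℝ} (hx : ∀ i s k j, 0 ≤ x i s k j)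
    (ha : ∀ i s k, Antitone (x i s k)) (hxs : ∀ i s k, Summable (x i s k))
    (hx1 : ∀ i s j, x i s true j ≤ 1 / 2)
    (hlim : ∀ᵐ θ : ℝ ∂volume.restrict (Set.Ioc (-Real.pi) Real.pi), Tendsto (fun i =>
      Complex.exp (θ * Complex.I) ^ n i * edreiProd (x i) (Complex.exp (θ * Complex.I)))
        atTop (𝓝 (F (Complex.exp (θ * Complex.I))))) :
    ∃ (m : ℤ) (y : Bool → Bool → ℕ → ℝ) (g : Bool → ℝ), (∀ s k j, 0 ≤ y s k j) ∧
      (∀ s k, Antitone (y s k)) ∧ (∀ s k, Summable (y s k)) ∧ (∀ s j, y s true j ≤ 1 / 2) ∧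
      (∀ s, 0 ≤ g s) ∧ ∀ u : ℂ, ‖u‖ = 1 →
        F u = u ^ m * (Complex.exp (∑ s, g s * edreiPoint s u) * edreiProd y u) := by
  have hu := Complex.norm_exp_ofReal_mul_I
  obtain ⟨θ, hθ, hθF, hθim⟩ : ∃ θ : ℝ, Tendsto (fun i => Complex.exp (θ * Complex.I) ^ n i *
      edreiProd (x i) (Complex.exp (θ * Complex.I))) atTop (𝓝 (F (Complex.exp (θ * Complex.I)))) ∧
      F (Complex.exp (θ * Complex.I)) ≠ 0 ∧ (Complex.exp (θ * Complex.I)).im ≠ 0 := by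
    by_contra! hcon
    have h1 : (fun θ : ℝ => F (Complex.exp (θ * Complex.I)))
        =ᵐ[volume.restrict (Set.Ioc (-Real.pi) Real.pi)] fun _ => 0 := by
      filter_upwards [hlim, ae_restrict_of_ae ae_exp_ofReal_mul_I_im_ne_zero] with θ h2 h3
      by_contra h4
      exact h3 (hcon θ h2 h4)
    have h5 := Measure.eqOn_Ioc_of_ae_eq _ h1 hF.continuousOn continuousOn_const
      (x := 0) ⟨by linarith [Real.pi_pos], Real.pi_pos.le⟩
    simp [hF1] at h5
  have hc : 0 < ‖F (Complex.exp (θ * Complex.I))‖ / 2 := half_pos (norm_pos_iff.2 hθF)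
  obtain ⟨K, hK⟩ := eventually_atTop.1
    (hθ.norm.eventually_const_lt (half_lt_self (norm_pos_iff.2 hθF)))
  have hC := fun i s k => tsum_le_of_le_norm_edreiProd (hx (i + K)) (hxs (i + K))
    (hx1 (i + K)) (hu θ)
    (re_lt_one_of_norm_eq_one (hu θ) hθim) hc (by
      have := hK (i + K) (by omega)
      rw [norm_mul, norm_exp_ofReal_mul_I_zpow, one_mul] at this
      exact this.le) s k
  obtain ⟨ψ, y, g, hψ, hya, hys, hg, hxy, hprod⟩ := exists_subseq_tendsto_edreiProd
    (x := fun i => x (i + K)) (fun i => hx (i + K)) (fun i => ha (i + K))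
    (fun i s k => (hxs (i + K) s k).hasSum) hC
  have hy : ∀ s k j, 0 ≤ y s k j := fun s k j => ge_of_tendsto' (hxy s k j) fun i => hx _ s k j
  have hψK : Tendsto (fun i => ψ i + K) atTop atTop :=
    (tendsto_add_atTop_nat K).comp hψ.tendsto_atTop
  have hlim2 : ∀ᵐ θ : ℝ ∂volume.restrict (Set.Ioc (-Real.pi) Real.pi), Tendsto (fun i =>
      Complex.exp (θ * Complex.I) ^ n (ψ i + K) *
        edreiProd (x (ψ i + K)) (Complex.exp (θ * Complex.I)))
        atTop (𝓝 (F (Complex.exp (θ * Complex.I)))) :=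
    hlim.mono fun θ hθ => hθ.comp hψK
  have hcont : Continuous fun θ : ℝ => Complex.exp (θ * Complex.I) := by fun_prop
  obtain ⟨m, hm⟩ := exists_frequently_eq_of_ae_tendsto hF hF1 (n := fun i => n (ψ i + K))
    (P := fun i => edreiProd (x (ψ i + K)))
    (fun i u hu => norm_edreiProd_le_one (hx _) (hxs _) (hx1 _) hu)
    (fun i => continuous_edreiProd_comp (hx _) (hxs _) hcont hu) hprod hlim2
  obtain ⟨η, hη, hηm⟩ := extraction_of_frequently_atTop hm
  refine ⟨m, y, g, hy, hya, hys, fun s j => le_of_tendsto' (hxy s true j) fun i => hx1 _ s j, hg,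
    fun u hu1 => ?_⟩
  have hae : (fun θ : ℝ => F (Complex.exp (θ * Complex.I)))
      =ᵐ[volume.restrict (Set.Ioc (-Real.pi) Real.pi)]
          fun θ : ℝ => Complex.exp (θ * Complex.I) ^ m *
        (Complex.exp (∑ s, g s * edreiPoint s (Complex.exp (θ * Complex.I))) *
          edreiProd y (Complex.exp (θ * Complex.I))) := by
    filter_upwards [hlim2] with θ hθ
    refine tendsto_nhds_unique (hθ.comp hη.tendsto_atTop) ?_
    refine (((hprod _ (hu θ)).comp hη.tendsto_atTop).const_mul
      (Complex.exp (θ * Complex.I) ^ m)).congr fun i => ?_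
    simp only [Function.comp_apply, hηm]
  have hcont2 : Continuous fun θ : ℝ => Complex.exp (θ * Complex.I) ^ m *
        (Complex.exp (∑ s, g s * edreiPoint s (Complex.exp (θ * Complex.I))) *
          edreiProd y (Complex.exp (θ * Complex.I))) := by
    refine (continuous_exp_zpow m).mul (Continuous.mul ?_
      (continuous_edreiProd_comp hy hys hcont hu))
    exact Complex.continuous_exp.comp (continuous_finsetSum _ fun s _ =>
      continuous_const.mul (continuous_edreiPoint_comp s hcont hu))
  have h6 := Measure.eqOn_Ioc_of_ae_eq _ hae hF.continuousOn hcont2.continuousOn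
    (x := Complex.arg u) (Complex.arg_mem_Ioc u)
  have h7 : Complex.exp (Complex.arg u * Complex.I) = u := by
    have := Complex.norm_mul_exp_arg_mul_I u
    rwa [hu1, Complex.ofReal_one, one_mul] at this
  simpa only [h7] using h6

theorem TotallyPositive.exists_zpow_mul_edrei_form {φ : ℤ → ℝ} (hφ : TotallyPositive φ)
    (h1 : HasSum φ 1) :
    ∃ (m : ℤ) (y : Bool → Bool → ℕ → ℝ) (g : Bool → ℝ), (∀ s k j, 0 ≤ y s k j) ∧
      (∀ s k, Antitone (y s k)) ∧ (∀ s k, Summable (y s k)) ∧ (∀ s j, y s true j ≤ 1 / 2) ∧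
      (∀ s, 0 ≤ g s) ∧ ∀ u : ℂ, ‖u‖ = 1 → ∑' n : ℤ, (φ n : ℂ) * u ^ n =
        u ^ m * (Complex.exp (∑ s, g s * edreiPoint s u) * edreiProd y u) := by
  obtain ⟨M, l, hM, hl, hlim⟩ := exists_ae_tendsto_charRatio hφ h1
  choose n x hx ha hxs hx1 hrat using fun i => charRatio_eq_zpow_mul_edreiProd (hM i) (hl i)
  refine exists_edrei_form_of_ae_tendsto (F := fun u => ∑' n : ℤ, (φ n : ℂ) * u ^ n)
    (continuous_tsum_mul_exp_zpow hφ.nonneg h1.summable) ?_ (n := n) hx ha hxs hx1 ?_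
  · simp only [one_zpow, mul_one]
    rw [(Complex.hasSum_ofReal.2 h1).tsum_eq]
    simp
  · filter_upwards [hlim, ae_restrict_of_ae ae_exp_ofReal_mul_I_im_ne_zero] with θ h hθ
    exact h.congr fun i => hrat i _ (Complex.norm_exp_ofReal_mul_I θ) hθ

theorem edreiPoint_not (s : Bool) (u : ℂ) : edreiPoint (!s) u = edreiPoint s u⁻¹ := by
  cases s <;> simp [edreiPoint]

theorem edreiProd_comp_not (x : Bool → Bool → ℕ → ℝ) (u : ℂ) :
    edreiProd (fun s => x !s) u = edreiProd x u⁻¹ := by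
  simp only [edreiProd, Fintype.prod_bool, ← edreiPoint_not, Bool.not_true, Bool.not_false]
  ring

/-- The data obtained from `x` on multiplying the associated product by `u`, which trades the
factor `1 + b (u⁻¹ - 1)` for the factor `1 + (1 - b) (u - 1)`. -/
def edreiShift (x : Bool → Bool → ℕ → ℝ) : Bool → Bool → ℕ → ℝ
  | true, true, 0 => 1 - x false true 0
  | true, true, i + 1 => x true true i
  | false, true, i => x false true (i + 1)
  | s, false, i => x s false i

/-- Nonnegative, nonincreasing, summable data with `x true true 0 + x false true 0 ≤ 1`. -/
structure IsEdreiData (x : Bool → Bool → ℕ → ℝ) : Prop where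
  nonneg : ∀ s k i, 0 ≤ x s k i
  antitone : ∀ s k, Antitone (x s k)
  summable : ∀ s k, Summable (x s k)
  add_le_one : x true true 0 + x false true 0 ≤ 1

theorem IsEdreiData.comp_not {x : Bool → Bool → ℕ → ℝ} (h : IsEdreiData x) :
    IsEdreiData fun s => x !s :=
  ⟨fun _ => h.nonneg _, fun _ => h.antitone _, fun _ => h.summable _,
    (add_comm _ _).trans_le h.add_le_one⟩

theorem IsEdreiData.edreiShift {x : Bool → Bool → ℕ → ℝ} (h : IsEdreiData x) :
    IsEdreiData (edreiShift x) where
  nonneg := by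
    rintro (_ | _) (_ | _) (_ | i) <;> simp only [_root_.edreiShift, h.nonneg]
    linarith [h.add_le_one, h.nonneg true true 0]
  antitone := by
    rintro (_ | _) (_ | _)
    · exact h.antitone _ _
    · exact fun i j hij => h.antitone _ _ (Nat.succ_le_succ hij)
    · exact h.antitone _ _
    · refine antitone_nat_of_succ_le fun i => ?_
      cases i with
      | zero =>
        simp only [_root_.edreiShift]
        linarith [h.add_le_one]
      | succ i => exact h.antitone _ _ (Nat.le_succ i)
  summable := by
    rintro (_ | _) (_ | _)
    · exact h.summable _ _
    · exact (summable_nat_add_iff 1).2 (h.summable _ _)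
    · exact h.summable _ _
    · exact (summable_nat_add_iff 1).1 (h.summable true true)
  add_le_one := by
    simp only [_root_.edreiShift]
    linarith [h.antitone false true (Nat.le_succ 0)]

theorem IsEdreiData.mul_edreiProd {x : Bool → Bool → ℕ → ℝ} (h : IsEdreiData x) {u : ℂ}
    (hu : ‖u‖ = 1) : u * edreiProd x u = edreiProd (_root_.edreiShift x) u := by
  have hu0 : u ≠ 0 := fun h => by simp [h] at hu
  have hp := multipliable_edreiFactor true (h.nonneg true true) (h.summable _ _)
    (edreiPoint_re_nonpos true hu)
  have hm := multipliable_edreiFactor true (h.edreiShift.nonneg false true)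
    (h.edreiShift.summable _ _) (edreiPoint_re_nonpos false hu)
  have h1 := tprod_eq_zero_mul' (f := fun i => edreiFactor true
    (_root_.edreiShift x true true i * edreiPoint true u)) hp
  have h2 := tprod_eq_zero_mul' (f := fun i => edreiFactor true
    (x false true i * edreiPoint false u)) hm
  simp only [edreiProd, Fintype.prod_bool]
  rw [h1, h2]
  simp only [_root_.edreiShift]
  have h3 : u * edreiFactor true (x false true 0 * edreiPoint false u) =
      edreiFactor true ((1 - x false true 0 : ℝ) * edreiPoint true u) := by
    simp only [edreiFactor, edreiPoint, if_true, Bool.false_eq_true, if_false]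
    push_cast
    field_simp
    ring
  rw [← h3]
  ring

theorem IsEdreiData.exists_pow_mul_edreiProd {x : Bool → Bool → ℕ → ℝ} (h : IsEdreiData x)
    (n : ℕ) : ∃ y, IsEdreiData y ∧ ∀ u : ℂ, ‖u‖ = 1 → u ^ n * edreiProd x u = edreiProd y u := by
  induction n with
  | zero => exact ⟨x, h, fun u _ => by simp⟩
  | succ n ih =>
    obtain ⟨y, hy, hxy⟩ := ih
    refine ⟨_, hy.edreiShift, fun u hu => ?_⟩
    rw [← hy.mul_edreiProd hu, ← hxy u hu]
    ring

theorem IsEdreiData.exists_zpow_mul_edreiProd {x : Bool → Bool → ℕ → ℝ} (h : IsEdreiData x)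
    (n : ℤ) : ∃ y, IsEdreiData y ∧ ∀ u : ℂ, ‖u‖ = 1 → u ^ n * edreiProd x u = edreiProd y u := by
  obtain ⟨n, rfl | rfl⟩ := n.eq_nat_or_neg
  · simpa using h.exists_pow_mul_edreiProd n
  · obtain ⟨y, hy, hxy⟩ := h.comp_not.exists_pow_mul_edreiProd n
    refine ⟨_, hy.comp_not, fun u hu => ?_⟩
    rw [edreiProd_comp_not, ← hxy _ (by simpa using hu), edreiProd_comp_not, inv_inv]
    simp

/-- The nested families of the two-sided parameters, from the four sequences. -/
def edreiData (ap am bp bm : ℕ → ℝ) : Bool → Bool → ℕ → ℝ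
  | true, true => bp
  | true, false => ap
  | false, true => bm
  | false, false => am

end

/-- Edrei's classification of normalized totally positive sequences (Theorem 9.A):
`φ : ℤ → ℝ` is nonnegative, sums to `1` and is totally positive iff its generating series
`∑_{n ∈ ℤ} φ_n uⁿ` (absolutely convergent on the unit circle) has the Edrei–Voiculescu
form `e^{γ⁺(u-1)+γ⁻(u⁻¹-1)} ∏_i (1+β⁺_i(u-1))(1+β⁻_i(u⁻¹-1)) /
((1-α⁺_i(u-1))(1-α⁻_i(u⁻¹-1)))` for some data `(α^±, β^±, γ^±)` as below. -/
theorem edrei_classification (φ : ℤ → ℝ) :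
    ((∀ n : ℤ, 0 ≤ φ n) ∧ HasSum φ 1 ∧ TotallyPositive φ) ↔
    (∃ (ap am bp bm : ℕ → ℝ) (gp gm : ℝ),
      (∀ i, 0 ≤ ap i) ∧ (∀ i, 0 ≤ am i) ∧ (∀ i, 0 ≤ bp i) ∧ (∀ i, 0 ≤ bm i) ∧
      Antitone ap ∧ Antitone am ∧ Antitone bp ∧ Antitone bm ∧
      Summable (fun i => ap i + bp i) ∧ Summable (fun i => am i + bm i) ∧
      bp 0 + bm 0 ≤ 1 ∧ 0 ≤ gp ∧ 0 ≤ gm ∧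
      ∀ u : ℂ, ‖u‖ = 1 →
        (∀ i : ℕ, (1 - (ap i : ℂ) * (u - 1)) ≠ 0 ∧ (1 - (am i : ℂ) * (u⁻¹ - 1)) ≠ 0) ∧
        Multipliable (fun i : ℕ =>
          ((1 + (bp i : ℂ) * (u - 1)) * (1 + (bm i : ℂ) * (u⁻¹ - 1))) /
            ((1 - (ap i : ℂ) * (u - 1)) * (1 - (am i : ℂ) * (u⁻¹ - 1)))) ∧
        Summable (fun n : ℤ => ‖(φ n : ℂ) * u ^ n‖) ∧
        HasSum (fun n : ℤ => (φ n : ℂ) * u ^ n)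
          (Complex.exp ((gp : ℂ) * (u - 1) + (gm : ℂ) * (u⁻¹ - 1)) *
            ∏' i : ℕ,
              ((1 + (bp i : ℂ) * (u - 1)) * (1 + (bm i : ℂ) * (u⁻¹ - 1))) /
                ((1 - (ap i : ℂ) * (u - 1)) * (1 - (am i : ℂ) * (u⁻¹ - 1))))) := by
  constructor
  · rintro ⟨h0, h1, hφ⟩
    obtain ⟨m, y, g, hy, ha, hys, hy1, hg, hF⟩ := hφ.exists_zpow_mul_edrei_form h1
    obtain ⟨x, hx, hxy⟩ := IsEdreiData.exists_zpow_mul_edreiProd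
      ⟨hy, ha, hys, by linarith [hy1 true 0, hy1 false 0]⟩ m
    refine ⟨x true false, x false false, x true true, x false true, g true, g false,
      hx.nonneg _ _, hx.nonneg _ _, hx.nonneg _ _, hx.nonneg _ _, hx.antitone _ _,
      hx.antitone _ _, hx.antitone _ _, hx.antitone _ _, (hx.summable _ _).add (hx.summable _ _),
      (hx.summable _ _).add (hx.summable _ _), hx.add_le_one, hg _, hg _, fun u hu => ?_⟩
    have hP := edreiProd_eq_tprod hx.nonneg hx.summable hu
    have hsum : Summable fun n : ℤ => ‖(φ n : ℂ) * u ^ n‖ :=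
      h1.summable.congr fun n => by simp [hu, abs_of_nonneg (h0 n)]
    refine ⟨fun i => ⟨?_, ?_⟩, hP.multipliable, hsum, ?_⟩
    · exact one_sub_ne_zero_of_re_nonpos (real_mul_re_nonpos (hx.nonneg _ _ _)
        (by simpa [edreiPoint] using edreiPoint_re_nonpos true hu))
    · exact one_sub_ne_zero_of_re_nonpos (real_mul_re_nonpos (hx.nonneg _ _ _)
        (by simpa [edreiPoint] using edreiPoint_re_nonpos false hu))
    · have h := hsum.of_norm.hasSum
      rw [hF u hu, mul_left_comm, hxy u hu] at h
      rw [hP.tprod_eq]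
      simpa [edreiPoint] using h
  · rintro ⟨ap, am, bp, bm, gp, gm, hap, ham, hbp, hbm, -, -, hbpa, hbma, hp, hm, h1, hgp, hgm, h⟩
    set x := edreiData ap am bp bm
    have hx : ∀ s k i, 0 ≤ x s k i := by rintro (_ | _) (_ | _) <;> assumption
    have hxs : ∀ s k, Summable (x s k) := by
      rintro (_ | _) (_ | _)
      · exact hm.of_nonneg_of_le ham fun i => le_add_of_nonneg_right (hbm i)
      · exact hm.of_nonneg_of_le hbm fun i => le_add_of_nonneg_left (ham i)
      · exact hp.of_nonneg_of_le hap fun i => le_add_of_nonneg_right (hbp i)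
      · exact hp.of_nonneg_of_le hbp fun i => le_add_of_nonneg_left (hap i)
    have hx1 : ∀ s i, x s true i ≤ 1 := by
      rintro (_ | _) i
      · exact (hbma (Nat.zero_le i)).trans (by linarith [hbp 0])
      · exact (hbpa (Nat.zero_le i)).trans (by linarith [hbm 0])
    have hφ : TotallyPositive φ := by
      refine totallyPositive_of_edrei_form (g := fun s => if s then gp else gm) hx hxs hx1
        (by rintro (_ | _) <;> simpa) ?_ fun u hu => ?_
      · simpa using (h 1 (by simp)).2.2.1
      · rw [← (edreiProd_eq_tprod hx hxs hu).tprod_eq]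
        simpa [edreiPoint, x, edreiData] using (h u hu).2.2.2
    refine ⟨hφ.nonneg, ?_, hφ⟩
    rw [← Complex.hasSum_ofReal]
    simpa using (h 1 (by simp)).2.2.2
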